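/- arXiv:0710.3238 — 14 statements merged into one kernel-verified Lean document; each statement's English description precedes it below -/
import Mathlib

section
/- Let U ⊆ ℝ² be open, let P, Q : U → ℝ be C¹, let V : U → ℝ be an inverse integrating factor of the vector field X = P ∂x + Q ∂y on U, and let Φ : I → U (with I ⊆ ℝ an interval containing 0) be a solution of the system ẋ = P(x,y), ẏ = Q(x,y) with Φ(0) = p. Then for every t ∈ I one has V(Φ(t)) = V(p) · exp(∫₀ᵗ (div X)(Φ(s)) ds), where div X = ∂P/∂x + ∂Q/∂y. In particular, if V(p) = 0 then V vanishes identically along the orbit Φ. -/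
/-- Along any solution `Φ` of the planar system `ẋ = P, ẏ = Q`, a C¹ inverse
integrating factor `V` satisfies
`V(Φ t) = V(p) · exp (∫₀ᵗ div X (Φ s) ds)`; in particular if `V p = 0` then
`V` vanishes identically along the orbit. -/
theorem stmt_0
    (U : Set (ℝ × ℝ)) (hU : IsOpen U)
    (P Q V : ℝ × ℝ → ℝ)
    (hP : ContDiffOn ℝ 1 P U) (hQ : ContDiffOn ℝ 1 Q U)
    (hV : ContDiffOn ℝ 1 V U)
    (hVif : ∀ z ∈ U,
      P z * fderiv ℝ V z (1, 0) + Q z * fderiv ℝ V z (0, 1)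
        = V z * (fderiv ℝ P z (1, 0) + fderiv ℝ Q z (0, 1)))
    (I : Set ℝ) (hI : I.OrdConnected) (h0 : (0 : ℝ) ∈ I)
    (Φ : ℝ → ℝ × ℝ) (hΦU : ∀ t ∈ I, Φ t ∈ U)
    (hΦ : ∀ t ∈ I, HasDerivAt Φ (P (Φ t), Q (Φ t)) t)
    (p : ℝ × ℝ) (hp : Φ 0 = p) :
    (∀ t ∈ I, V (Φ t) = V p *
      Real.exp (∫ s in (0 : ℝ)..t,
        (fderiv ℝ P (Φ s) (1, 0) + fderiv ℝ Q (Φ s) (0, 1))))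
    ∧ (V p = 0 → ∀ t ∈ I, V (Φ t) = 0) := by
  have key : ∀ t ∈ I, V (Φ t) = V p *
      Real.exp (∫ s in (0 : ℝ)..t,
        (fderiv ℝ P (Φ s) (1, 0) + fderiv ℝ Q (Φ s) (0, 1))) := by
    intro t ht
    set f : ℝ → ℝ := fun s => fderiv ℝ P (Φ s) (1, 0) + fderiv ℝ Q (Φ s) (0, 1) with hf
    have hsub : Set.uIcc 0 t ⊆ I := hI.uIcc_subset h0 ht
    have hΦc : ContinuousOn Φ I := fun s hs => (hΦ s hs).continuousAt.continuousWithinAt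
    have hfc : ContinuousOn f I := by
      have h1 := (hP.continuousOn_fderiv_of_isOpen hU le_rfl).comp hΦc hΦU
      have h2 := (hQ.continuousOn_fderiv_of_isOpen hU le_rfl).comp hΦc hΦU
      exact (h1.clm_apply continuousOn_const).add (h2.clm_apply continuousOn_const)
    let r : ℝ → ℝ := fun s => max (min 0 t) (min (max 0 t) s)
    have hr : ∀ s, r s ∈ Set.uIcc 0 t := fun s =>
      ⟨le_max_left _ _, max_le min_le_max (min_le_left _ _)⟩
    have hrs : ∀ s ∈ Set.uIcc 0 t, r s = s := by
      intro s hs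
      have h1 : min 0 t ≤ s := hs.1
      have h2 : s ≤ max 0 t := hs.2
      simp only [r]
      rw [min_eq_right h2, max_eq_right h1]
    have hrc : Continuous r := by fun_prop
    have hFc : Continuous (fun s => f (r s)) :=
      hfc.comp_continuous hrc (fun s => hsub (hr s))
    have hint : ∫ s in (0:ℝ)..t, f s = ∫ s in (0:ℝ)..t, f (r s) :=
      intervalIntegral.integral_congr (fun s hs => by simp only [hrs s hs])
    have hW : ∀ s ∈ Set.uIcc 0 t, HasDerivWithinAt
        (fun s => V (Φ s) * Real.exp (-∫ u in (0:ℝ)..s, f (r u))) 0 (Set.uIcc 0 t) s := by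
      intro s hs
      have hz := hΦU s (hsub hs)
      have hd : HasFDerivAt V (fderiv ℝ V (Φ s)) (Φ s) :=
        ((hV.differentiableOn one_ne_zero).differentiableAt (hU.mem_nhds hz)).hasFDerivAt
      have h1 := hd.comp_hasDerivAt s (hΦ s (hsub hs))
      have h2 := (hFc.integral_hasStrictDerivAt 0 s).hasDerivAt.neg.exp
      have h3 := h1.mul h2
      refine (h3.congr_deriv ?_).hasDerivWithinAt
      have e : ((P (Φ s), Q (Φ s)) : ℝ × ℝ)
          = P (Φ s) • ((1, 0) : ℝ × ℝ) + Q (Φ s) • ((0, 1) : ℝ × ℝ) := by simp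
      have h4 : fderiv ℝ V (Φ s) (P (Φ s), Q (Φ s)) = V (Φ s) * f s := by
        rw [e, map_add, map_smul, map_smul, smul_eq_mul, smul_eq_mul]
        exact hVif _ hz
      rw [h4, hrs s hs]
      simp only [Function.comp, Pi.neg_apply]
      ring
    have hconst := (convex_uIcc (0:ℝ) t).norm_image_sub_le_of_norm_hasDerivWithin_le
      (C := 0) hW (by simp) Set.left_mem_uIcc Set.right_mem_uIcc
    rw [zero_mul, norm_le_zero_iff, sub_eq_zero] at hconst
    simp only [intervalIntegral.integral_same, neg_zero, Real.exp_zero, mul_one, hp] at hconst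
    rw [hint, ← hconst, mul_assoc, ← Real.exp_add]
    simp
  refine ⟨key, fun h t ht => ?_⟩
  rw [key t ht, h, zero_mul]
end

section
/- Let L > 0, ε > 0, let F : [0,L] × (−ε,ε) → ℝ be C¹, and let Ψ(s; n₀) denote the flow of the scalar ODE dn/ds = F(s,n) with initial condition Ψ(0; n₀) = n₀; assume Ψ is defined and C¹ jointly in (s, n₀) for all s ∈ [0,L] and all n₀ in a neighborhood of 0. Let Ṽ be a C¹ inverse integrating factor of this ODE, i.e. ∂Ṽ/∂s + F ∂Ṽ/∂n = (∂F/∂n) Ṽ. Then for every such n₀ the identity Ṽ(L, Ψ(L; n₀)) = Ṽ(0, n₀) · (∂Ψ/∂n₀)(L; n₀) holds. (In curvilinear coordinates along a regular orbit, with the Poincaré map Π(n₀) = Ψ(L; n₀) between the transversal sections {s=0} and {s=L}, this reads Ṽ(L, Π(σ)) = Ṽ(0, σ) Π'(σ).) -/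
theorem ftc_aux (L : ℝ) (g : ℝ → ℝ) (hg : ContinuousOn g (Set.Icc 0 L)) :
    ∀ s ∈ Set.Ioo 0 L, HasDerivAt (fun s => ∫ t in (0:ℝ)..s, g t) (g s) s := by
  intro s hs
  have hi : IntervalIntegrable g MeasureTheory.volume 0 s := by
    apply ContinuousOn.intervalIntegrable
    rw [Set.uIcc_of_le hs.1.le]
    exact hg.mono (Set.Icc_subset_Icc_right hs.2.le)
  refine intervalIntegral.integral_hasDerivAt_right hi ?_ ?_
  · exact (hg.mono Set.Ioo_subset_Icc_self).stronglyMeasurableAtFilter isOpen_Ioo s hs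
  · exact hg.continuousAt (Icc_mem_nhds hs.1 hs.2)

theorem ftc_cont (L : ℝ) (hL : 0 < L) (g : ℝ → ℝ) (hg : ContinuousOn g (Set.Icc 0 L)) :
    ContinuousOn (fun s => ∫ t in (0:ℝ)..s, g t) (Set.Icc 0 L) := by
  have h := intervalIntegral.continuousOn_primitive_interval (μ := MeasureTheory.volume)
    (f := g) (a := 0) (b := L)
    (by rw [Set.uIcc_of_le hL.le]; exact hg.integrableOn_Icc)
  rwa [Set.uIcc_of_le hL.le] at h

theorem lin_aux (L : ℝ) (hL : 0 < L) (a W D : ℝ → ℝ) (ha : ContinuousOn a (Set.Icc 0 L))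
    (hW : ContinuousOn W (Set.Icc 0 L)) (hD : ContinuousOn D (Set.Icc 0 L))
    (hW' : ∀ s ∈ Set.Ioo 0 L, HasDerivAt W (a s * W s) s)
    (hD' : ∀ s ∈ Set.Ioo 0 L, HasDerivAt D (a s * D s) s) (hD0 : D 0 = 1) :
    W L = W 0 * D L := by
  set A : ℝ → ℝ := fun s => ∫ t in (0:ℝ)..s, a t with hA
  have hAc : ContinuousOn A (Set.Icc 0 L) := ftc_cont L hL a ha
  obtain ⟨c, hc, h⟩ := exists_hasDerivAt_eq_slope
    (fun s => (W s - W 0 * D s) * Real.exp (-A s)) (fun _ => 0) hL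
    ((hW.sub (hD.const_mul (W 0))).mul (Real.continuous_exp.comp_continuousOn hAc.neg))
    (by
      intro s hs
      have h1 := ((hW' s hs).sub ((hD' s hs).const_mul (W 0))).mul
        ((ftc_aux L a ha s hs).neg.exp)
      refine h1.congr_deriv ?_
      simp only [Pi.sub_apply, Pi.neg_apply]
      ring)
  have h2 : (W L - W 0 * D L) * Real.exp (-A L) = 0 := by
    have := hL.ne'
    field_simp at h
    simp [hD0] at h
    simpa using h
  have := (mul_eq_zero.1 h2).resolve_right (Real.exp_ne_zero _)
  linarith


/-- In curvilinear coordinates along a regular orbit, an inverse integrating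
factor `Vt` of the scalar ODE `dn/ds = F(s,n)` satisfies
`Vt (L, Ψ L n₀) = Vt (0, n₀) · (∂Ψ/∂n₀)(L; n₀)`, i.e. for the Poincaré map
`Π(n₀) = Ψ(L; n₀)` one has `Ṽ(L, Π(σ)) = Ṽ(0, σ) Π'(σ)`. -/
theorem stmt_1
    (L eps δ : ℝ) (hL : 0 < L) (heps : 0 < eps) (hδ : 0 < δ)
    (F : ℝ × ℝ → ℝ) (Ψ : ℝ → ℝ → ℝ) (Vt : ℝ × ℝ → ℝ)
    (hF : ContDiffOn ℝ 1 F (Set.Icc 0 L ×ˢ Set.Ioo (-eps) eps))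
    (hΨjoint : ContDiffOn ℝ 1 (fun z : ℝ × ℝ => Ψ z.1 z.2)
      (Set.Icc 0 L ×ˢ Set.Ioo (-δ) δ))
    (hΨ0 : ∀ n₀ ∈ Set.Ioo (-δ) δ, Ψ 0 n₀ = n₀)
    (hΨrange : ∀ s ∈ Set.Icc (0 : ℝ) L, ∀ n₀ ∈ Set.Ioo (-δ) δ,
      Ψ s n₀ ∈ Set.Ioo (-eps) eps)
    (hflow : ∀ n₀ ∈ Set.Ioo (-δ) δ, ∀ s ∈ Set.Icc (0 : ℝ) L,
      HasDerivAt (fun t => Ψ t n₀) (F (s, Ψ s n₀)) s)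
    (hVt : ContDiffOn ℝ 1 Vt (Set.Icc 0 L ×ˢ Set.Ioo (-eps) eps))
    (hpde : ∀ z ∈ Set.Icc (0 : ℝ) L ×ˢ Set.Ioo (-eps) eps,
      fderiv ℝ Vt z (1, 0) + F z * fderiv ℝ Vt z (0, 1)
        = fderiv ℝ F z (0, 1) * Vt z) :
    ∀ n₀ ∈ Set.Ioo (-δ) δ,
      Vt (L, Ψ L n₀) = Vt (0, n₀) * deriv (fun n => Ψ L n) n₀ := by
  intro n₀ hn₀
  set K := Set.Icc (0:ℝ) L ×ˢ Set.Ioo (-δ) δ with hK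
  set K' := Set.Icc (0:ℝ) L ×ˢ Set.Ioo (-eps) eps with hK'
  have uK : UniqueDiffOn ℝ K := (uniqueDiffOn_Icc hL).prod isOpen_Ioo.uniqueDiffOn
  have uK' : UniqueDiffOn ℝ K' := (uniqueDiffOn_Icc hL).prod isOpen_Ioo.uniqueDiffOn
  set P : ℝ × ℝ → ℝ × ℝ := fun z => (z.1, Ψ z.1 z.2) with hP
  have mP : Set.MapsTo P K K' := fun z hz => ⟨hz.1, hΨrange _ hz.1 _ hz.2⟩
  have cP : ContinuousOn P K := continuousOn_fst.prodMk hΨjoint.continuousOn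
  set Dz : ℝ × ℝ → ℝ := fun z => fderivWithin ℝ (fun z : ℝ × ℝ => Ψ z.1 z.2) K z (0, 1) with hDz
  have cD : ContinuousOn Dz K :=
    (hΨjoint.continuousOn_fderivWithin uK le_rfl).clm_apply continuousOn_const
  set a : ℝ × ℝ → ℝ := fun z => fderivWithin ℝ F K' (P z) (0, 1) with ha
  have ca : ContinuousOn a K :=
    ((hF.continuousOn_fderivWithin uK' le_rfl).comp cP mP).clm_apply continuousOn_const
  have cFP : ContinuousOn (fun z => F (P z)) K := hF.continuousOn.comp cP mP
  -- slices
  have msl : ∀ x ∈ Set.Ioo (-δ) δ, Set.MapsTo (fun s : ℝ => (s, x)) (Set.Icc 0 L) K :=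
    fun x hx s hs => ⟨hs, hx⟩
  have csl : ∀ x : ℝ, ContinuousOn (fun s : ℝ => (s, x)) (Set.Icc 0 L) :=
    fun x => by fun_prop
  -- derivative in n
  have dΨ : ∀ s ∈ Set.Icc 0 L, ∀ x ∈ Set.Ioo (-δ) δ, HasDerivAt (fun n => Ψ s n) (Dz (s, x)) x := by
    intro s hs x hx
    have h1 := (hΨjoint.differentiableOn one_ne_zero (s, x) ⟨hs, hx⟩).hasFDerivWithinAt
    have h2 : HasDerivWithinAt (fun n : ℝ => (s, n)) ((0:ℝ), (1:ℝ)) (Set.Ioo (-δ) δ) x :=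
      (hasDerivWithinAt_const _ _ _).prodMk (hasDerivWithinAt_id _ _)
    exact (h1.comp_hasDerivWithinAt x h2 (fun n hn => ⟨hs, hn⟩)).hasDerivAt
      (isOpen_Ioo.mem_nhds hx)
  have dF : ∀ s ∈ Set.Icc 0 L, ∀ x ∈ Set.Ioo (-δ) δ,
      HasDerivAt (fun n => F (P (s, n))) (a (s, x) * Dz (s, x)) x := by
    intro s hs x hx
    have hm := mP (show (s, x) ∈ K from ⟨hs, hx⟩)
    have h1 := (hF.differentiableOn one_ne_zero _ hm).hasFDerivWithinAt
    have h2 : HasDerivWithinAt (fun n : ℝ => P (s, n)) ((0:ℝ), Dz (s, x)) (Set.Ioo (-δ) δ) x :=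
      (hasDerivWithinAt_const _ _ _).prodMk (dΨ s hs x hx).hasDerivWithinAt
    have h3 := (h1.comp_hasDerivWithinAt x h2 (fun n hn => mP ⟨hs, hn⟩)).hasDerivAt
      (isOpen_Ioo.mem_nhds hx)
    refine h3.congr_deriv ?_
    have : ((0:ℝ), Dz (s, x)) = Dz (s, x) • ((0:ℝ), (1:ℝ)) := by simp
    rw [this, map_smul, smul_eq_mul, mul_comm]
  -- integral equation
  have hint : ∀ s ∈ Set.Icc 0 L, ∀ x ∈ Set.Ioo (-δ) δ,
      Ψ s x = x + ∫ t in (0:ℝ)..s, F (P (t, x)) := by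
    intro s hs x hx
    have hsub : Set.uIcc 0 s ⊆ Set.Icc 0 L := by
      rw [Set.uIcc_of_le hs.1]; exact Set.Icc_subset_Icc_right hs.2
    rw [intervalIntegral.integral_eq_sub_of_hasDerivAt (f := fun t => Ψ t x)
      (fun t ht => hflow x hx t (hsub ht))]
    · simp [hΨ0 x hx]
    · exact ((cFP.comp (csl x) (msl x hx)).mono hsub).intervalIntegrable
  obtain ⟨r, hr, hball⟩ := Metric.nhds_basis_closedBall.mem_iff.1 (isOpen_Ioo.mem_nhds hn₀)
  have hcomp : IsCompact (Set.Icc (0:ℝ) L ×ˢ Metric.closedBall n₀ r) :=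
    isCompact_Icc.prod (isCompact_closedBall _ _)
  obtain ⟨C, hC⟩ := hcomp.exists_bound_of_continuousOn
    ((ca.mul cD).mono (Set.prod_mono le_rfl hball))
  have hDint : ∀ s ∈ Set.Icc 0 L,
      Dz (s, n₀) = 1 + ∫ t in (0:ℝ)..s, a (t, n₀) * Dz (t, n₀) := by
    intro s hs
    have hsub : Set.uIcc 0 s ⊆ Set.Icc 0 L := by
      rw [Set.uIcc_of_le hs.1]; exact Set.Icc_subset_Icc_right hs.2
    have hsub' : Set.uIoc 0 s ⊆ Set.Icc 0 L := Set.uIoc_subset_uIcc.trans hsub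
    have h1 := (intervalIntegral.hasDerivAt_integral_of_dominated_loc_of_deriv_le
      (μ := MeasureTheory.volume) (a := 0) (b := s) (x₀ := n₀)
      (F := fun x t => F (P (t, x))) (F' := fun x t => a (t, x) * Dz (t, x))
      (bound := fun _ => C) (Metric.closedBall_mem_nhds n₀ hr)
      (by
        filter_upwards [isOpen_Ioo.mem_nhds hn₀] with x hx
        exact ((cFP.comp (csl x) (msl x hx)).mono hsub').aestronglyMeasurable
          measurableSet_uIoc)
      ((cFP.comp (csl n₀) (msl n₀ hn₀)).mono hsub).intervalIntegrable
      ((((ca.mul cD).comp (csl n₀) (msl n₀ hn₀)).mono hsub').aestronglyMeasurable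
          measurableSet_uIoc)
      (Filter.Eventually.of_forall fun t ht x hx => hC (t, x) ⟨hsub' ht, hx⟩)
      intervalIntegrable_const
      (Filter.Eventually.of_forall fun t ht x hx => dF t (hsub' ht) x (hball hx))).2
    have h2 := (hasDerivAt_id n₀).add h1
    refine (dΨ s hs n₀ hn₀).unique (h2.congr_of_eventuallyEq ?_)
    filter_upwards [isOpen_Ioo.mem_nhds hn₀] with x hx
    exact hint s hs x hx
  have ca0 := ca.comp (csl n₀) (msl n₀ hn₀)
  have cD0 := cD.comp (csl n₀) (msl n₀ hn₀)
  have h0 : (0:ℝ) ∈ Set.Icc 0 L := ⟨le_rfl, hL.le⟩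
  have hLL : L ∈ Set.Icc 0 L := ⟨hL.le, le_rfl⟩
  rw [(dΨ L hLL n₀ hn₀).deriv]
  have key := lin_aux L hL (fun s => a (s, n₀)) (fun s => Vt (P (s, n₀))) (fun s => Dz (s, n₀))
    ca0 ((hVt.continuousOn.comp cP mP).comp (csl n₀) (msl n₀ hn₀)) cD0 ?_ ?_ ?_
  · simpa [hP, hΨ0 n₀ hn₀] using key
  · intro s hs
    have hs' := Set.Ioo_subset_Icc_self hs
    have hm := mP (show (s, n₀) ∈ K from ⟨hs', hn₀⟩)
    have hn : K' ∈ nhds (P (s, n₀)) :=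
      prod_mem_nhds (Icc_mem_nhds hs.1 hs.2) (isOpen_Ioo.mem_nhds hm.2)
    have h1 := ((hVt.differentiableOn one_ne_zero _ hm).differentiableAt hn).hasFDerivAt
    have h2 : HasDerivAt (fun t : ℝ => P (t, n₀)) ((1:ℝ), F (P (s, n₀))) s :=
      (hasDerivAt_id s).prodMk (hflow n₀ hn₀ s hs')
    have h3 := h1.comp_hasDerivAt s h2
    refine h3.congr_deriv ?_
    have e : ((1:ℝ), F (P (s, n₀))) = (1, 0) + F (P (s, n₀)) • ((0:ℝ), (1:ℝ)) := by simp
    rw [e, map_add, map_smul, smul_eq_mul, hpde _ hm]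
    simp only [ha]
    rw [fderivWithin_of_mem_nhds hn]
  · intro s hs
    have h1 := (ftc_aux L _ (ca0.mul cD0) s hs).const_add 1
    refine h1.congr_of_eventuallyEq ?_
    filter_upwards [Icc_mem_nhds hs.1 hs.2] with t ht
    exact hDint t ht
  · simpa using hDint 0 h0
end

section
/- Let L > 0, ε > 0, let F : [0,L] × (−ε,ε) → ℝ be C¹ with F(s,0) = 0 for all s (so n = 0 is a solution of dn/ds = F(s,n)), and let Ṽ be a C^m (m ≥ 1) inverse integrating factor of this ODE such that ∂ʲṼ/∂nʲ(s,0) = 0 for all s ∈ [0,L] and all 0 ≤ j ≤ m−1. Define ṽ(s) := (1/m!) ∂ᵐṼ/∂nᵐ(s,0). Then ṽ(s) = ṽ(0) · exp( (1−m) ∫₀ˢ (∂F/∂n)(σ,0) dσ ) for all s ∈ [0,L]; in particular, if ṽ(0) ≠ 0 then ṽ(s) ≠ 0 for every s ∈ [0,L]. -/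
open Set Filter Topology

/-- partial derivative in the second variable -/
noncomputable def pdn (V : ℝ × ℝ → ℝ) (z : ℝ × ℝ) : ℝ := deriv (fun n => V (z.1, n)) z.2

lemma sliceHas {L eps : ℝ} {V : ℝ × ℝ → ℝ} {s n : ℝ} (hs : s ∈ Icc 0 L) (hn : n ∈ Ioo (-eps) eps)
    (h : DifferentiableWithinAt ℝ V (Icc 0 L ×ˢ Ioo (-eps) eps) (s, n)) :
    HasDerivAt (fun n => V (s, n)) (fderivWithin ℝ V (Icc 0 L ×ˢ Ioo (-eps) eps) (s, n) (0, 1)) n := by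
  have h1 : HasDerivWithinAt (fun x : ℝ => (s, x)) ((0 : ℝ), (1 : ℝ)) (Ioo (-eps) eps) n :=
    ((hasDerivAt_const n s).prodMk (hasDerivAt_id n)).hasDerivWithinAt
  have h2 := h.hasFDerivWithinAt.comp_hasDerivWithinAt n h1 (fun x hx => ⟨hs, hx⟩)
  exact h2.hasDerivAt (isOpen_Ioo.mem_nhds hn)

lemma pdn_contDiffOn {L eps : ℝ} (hL : 0 < L) {V : ℝ × ℝ → ℝ} {k : ℕ}
    (hV : ContDiffOn ℝ ((k + 1 : ℕ) : WithTop ℕ∞) V (Icc 0 L ×ˢ Ioo (-eps) eps)) :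
    ContDiffOn ℝ (k : WithTop ℕ∞) (pdn V) (Icc 0 L ×ˢ Ioo (-eps) eps) := by
  have hU : UniqueDiffOn ℝ (Icc 0 L ×ˢ Ioo (-eps) eps) :=
    (uniqueDiffOn_Icc hL).prod isOpen_Ioo.uniqueDiffOn
  have h1 : ContDiffOn ℝ (k : WithTop ℕ∞) (fderivWithin ℝ V (Icc 0 L ×ˢ Ioo (-eps) eps))
      (Icc 0 L ×ˢ Ioo (-eps) eps) := hV.fderivWithin hU (by push_cast; exact le_rfl)
  have h2 := h1.clm_apply (contDiffOn_const (c := ((0 : ℝ), (1 : ℝ))))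
  refine h2.congr ?_
  rintro ⟨s, n⟩ ⟨hs, hn⟩
  exact (sliceHas hs hn ((hV.differentiableOn (by simp)) _ ⟨hs, hn⟩)).deriv

lemma iter_cont {L eps : ℝ} (hL : 0 < L) (k : ℕ) : ∀ V : ℝ × ℝ → ℝ,
    ContDiffOn ℝ (k : WithTop ℕ∞) V (Icc 0 L ×ˢ Ioo (-eps) eps) →
    ContinuousOn (fun z : ℝ × ℝ => iteratedDeriv k (fun n => V (z.1, n)) z.2)
      (Icc 0 L ×ˢ Ioo (-eps) eps) := by
  induction k with
  | zero => intro V hV; simpa using hV.continuousOn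
  | succ k ih =>
    intro V hV
    have := ih (pdn V) (pdn_contDiffOn hL hV)
    simp only [iteratedDeriv_succ']
    exact this

lemma taylorT {eps : ℝ} (heps : 0 < eps) (m : ℕ) : ∀ f : ℝ → ℝ,
    ContDiffOn ℝ (m : WithTop ℕ∞) f (Ioo (-eps) eps) →
    (∀ j < m, iteratedDeriv j f 0 = 0) → ∀ n ∈ Ioo 0 eps, ∃ ξ ∈ Ioc 0 n,
      f n * (m.factorial : ℝ) = iteratedDeriv m f ξ * n ^ m := by
  induction m with
  | zero => intro f _ _ n hn; exact ⟨n, ⟨hn.1, le_rfl⟩, by simp⟩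
  | succ m ih =>
    intro f hf h0 n hn
    have hd : ∀ x ∈ Ioo (-eps) eps, HasDerivAt f (deriv f x) x := fun x hx =>
      ((hf.differentiableOn (by simp)).differentiableAt (isOpen_Ioo.mem_nhds hx)).hasDerivAt
    have hsub : ∀ x ∈ Icc 0 n, x ∈ Ioo (-eps) eps := fun x hx =>
      ⟨by linarith [hx.1], by linarith [hx.2, hn.2]⟩
    have hf' : ContDiffOn ℝ (m : WithTop ℕ∞) (deriv f) (Ioo (-eps) eps) :=
      hf.deriv_of_isOpen isOpen_Ioo (by push_cast; exact le_rfl)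
    obtain ⟨c, hc, hce⟩ := exists_ratio_hasDerivAt_eq_ratio_slope f (deriv f) hn.1
      (fun x hx => (hd x (hsub x hx)).continuousAt.continuousWithinAt)
      (fun x hx => hd x (hsub x (Ioo_subset_Icc_self hx)))
      (fun x => x ^ (m + 1)) (fun x => ((m + 1 : ℕ) : ℝ) * x ^ m) (by fun_prop)
      (fun x hx => by simpa using hasDerivAt_pow (m + 1) x)
    obtain ⟨ξ, hξ, hξe⟩ := ih (deriv f) hf'
      (fun j hj => by rw [← iteratedDeriv_succ']; exact h0 _ (by omega)) c ⟨hc.1, hc.2.trans hn.2⟩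
    refine ⟨ξ, ⟨hξ.1, hξ.2.trans hc.2.le⟩, ?_⟩
    have hf0 : f 0 = 0 := by simpa using h0 0 (by omega)
    rw [iteratedDeriv_succ', Nat.factorial_succ]
    have hcm : c ^ m ≠ 0 := pow_ne_zero _ hc.1.ne'
    simp only [hf0, sub_zero, ne_eq, Nat.add_eq_zero_iff, one_ne_zero, and_false,
      not_false_eq_true, zero_pow] at hce
    apply mul_right_cancel₀ hcm
    push_cast at hce ⊢
    linear_combination (-(m.factorial : ℝ)) * hce + n ^ (m + 1) * hξe

lemma slice_cd {L eps : ℝ} {V : ℝ × ℝ → ℝ} {m : ℕ}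
    (hV : ContDiffOn ℝ (m : WithTop ℕ∞) V (Icc 0 L ×ˢ Ioo (-eps) eps)) {s : ℝ} (hs : s ∈ Icc 0 L) :
    ContDiffOn ℝ (m : WithTop ℕ∞) (fun n => V (s, n)) (Ioo (-eps) eps) :=
  hV.comp (f := fun n : ℝ => (s, n)) (by fun_prop) (fun x hx => ⟨hs, hx⟩)

lemma quotQ {L eps : ℝ} (hL : 0 < L) (heps : 0 < eps) {V : ℝ × ℝ → ℝ} {m : ℕ}
    (hV : ContDiffOn ℝ (m : WithTop ℕ∞) V (Icc 0 L ×ˢ Ioo (-eps) eps))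
    (h0 : ∀ s ∈ Icc 0 L, ∀ j < m, iteratedDeriv j (fun n => V (s, n)) 0 = 0) :
    ∃ C : ℝ, 0 ≤ C ∧ (∀ s ∈ Icc 0 L, ∀ n ∈ Ioc 0 (eps / 2), |V (s, n) / n ^ m| ≤ C) ∧
      ∀ s ∈ Icc 0 L, Tendsto (fun n => V (s, n) / n ^ m) (𝓝[>] 0)
        (𝓝 (1 / (m.factorial : ℝ) * iteratedDeriv m (fun n => V (s, n)) 0)) := by
  have hc := iter_cont hL m V hV
  have key : ∀ s ∈ Icc 0 L, ∀ n ∈ Ioo 0 eps, ∃ ξ ∈ Ioc 0 n,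
      V (s, n) / n ^ m = 1 / (m.factorial : ℝ) * iteratedDeriv m (fun n => V (s, n)) ξ := by
    intro s hs n hn
    obtain ⟨ξ, hξ, h⟩ := taylorT heps m _ (slice_cd hV hs) (h0 s hs) n hn
    refine ⟨ξ, hξ, ?_⟩
    have := hn.1.ne'
    have : (m.factorial : ℝ) ≠ 0 := by positivity
    field_simp
    linear_combination h
  obtain ⟨C, hC⟩ := (isCompact_Icc.prod isCompact_Icc : IsCompact
    (Icc (0 : ℝ) L ×ˢ Icc (0 : ℝ) (eps / 2))).exists_bound_of_continuousOn
    (hc.mono (prod_mono le_rfl (fun x hx => ⟨by linarith [hx.1], by linarith [hx.2]⟩)))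
  refine ⟨1 / (m.factorial : ℝ) * |C|, by positivity, ?_, ?_⟩
  · intro s hs n hn
    obtain ⟨ξ, hξ, h⟩ := key s hs n ⟨hn.1, by linarith [hn.2]⟩
    have := hC (s, ξ) ⟨hs, hξ.1.le, hξ.2.trans hn.2⟩
    rw [h, abs_mul, abs_of_nonneg (by positivity : (0 : ℝ) ≤ 1 / (m.factorial : ℝ))]
    exact mul_le_mul_of_nonneg_left (this.trans (le_abs_self C)) (by positivity)
  · intro s hs
    choose! ξ hξ hξe using key s hs
    have hev : ∀ᶠ n in 𝓝[>] (0 : ℝ), n ∈ Ioo 0 eps := Ioo_mem_nhdsGT heps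
    have hξt : Tendsto ξ (𝓝[>] 0) (𝓝 0) := by
      refine tendsto_of_tendsto_of_tendsto_of_le_of_le' tendsto_const_nhds
        (tendsto_id.mono_left nhdsWithin_le_nhds) ?_ ?_
      · filter_upwards [hev] with n hn using (hξ n hn).1.le
      · filter_upwards [hev] with n hn using (hξ n hn).2
    have hcs : ContinuousAt (iteratedDeriv m (fun n => V (s, n))) 0 := by
      have : ContinuousOn (fun n => iteratedDeriv m (fun n => V (s, n)) n) (Ioo (-eps) eps) :=
        hc.comp (f := fun n : ℝ => (s, n)) (by fun_prop) (fun x hx => ⟨hs, hx⟩)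
      exact this.continuousAt (Ioo_mem_nhds (by linarith) heps)
    refine ((hcs.tendsto.comp hξt).const_mul _).congr' ?_
    filter_upwards [hev] with n hn using (hξe n hn).symm

lemma odeLem {L c : ℝ} (hL : 0 < L) {a v : ℝ → ℝ} (ha : ContinuousOn a (Icc 0 L))
    (hv : ContinuousOn v (Icc 0 L))
    (h : ∀ s ∈ Icc 0 L, v s - v 0 = ∫ σ in (0 : ℝ)..s, c * (a σ * v σ)) :
    ∀ s ∈ Icc 0 L, v s = v 0 * Real.exp (c * ∫ σ in (0 : ℝ)..s, a σ) := by
  have hae : Continuous (IccExtend hL.le ((Icc 0 L).domRestrict a)) := ha.domRestrict.Icc_extend'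
  have hve : Continuous (IccExtend hL.le ((Icc 0 L).domRestrict v)) := hv.domRestrict.Icc_extend'
  set A := IccExtend hL.le ((Icc 0 L).domRestrict a) with hA
  set W := IccExtend hL.le ((Icc 0 L).domRestrict v) with hW
  have eA : ∀ x ∈ Icc 0 L, A x = a x := fun x hx => by rw [hA, IccExtend_of_mem _ _ hx]; rfl
  have eW : ∀ x ∈ Icc 0 L, W x = v x := fun x hx => by rw [hW, IccExtend_of_mem _ _ hx]; rfl
  have hsub : ∀ s ∈ Icc 0 L, ∀ x ∈ uIcc 0 s, x ∈ Icc 0 L := fun s hs x hx => by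
    rw [uIcc_of_le hs.1] at hx; exact ⟨hx.1, hx.2.trans hs.2⟩
  let u : ℝ → ℝ := fun s => v 0 + ∫ σ in (0 : ℝ)..s, c * (A σ * W σ)
  let G : ℝ → ℝ := fun s => ∫ σ in (0 : ℝ)..s, A σ
  have hu : ∀ s, HasDerivAt u (c * (A s * W s)) s := fun s =>
    (Continuous.integral_hasStrictDerivAt (by fun_prop) 0 s).hasDerivAt.const_add _
  have hG : ∀ s, HasDerivAt G (A s) s := fun s =>
    (hae.integral_hasStrictDerivAt 0 s).hasDerivAt
  have uv : ∀ s ∈ Icc 0 L, u s = v s := fun s hs => by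
    have : ∫ σ in (0 : ℝ)..s, c * (A σ * W σ) = ∫ σ in (0 : ℝ)..s, c * (a σ * v σ) :=
      intervalIntegral.integral_congr (fun x hx => by
        simp only [eA x (hsub s hs x hx), eW x (hsub s hs x hx)])
    simp only [u, this, ← h s hs]; ring
  have hh : ∀ s, HasDerivAt (fun s => u s * Real.exp (-(c * G s)))
      (c * (A s * W s) * Real.exp (-(c * G s)) +
        u s * (Real.exp (-(c * G s)) * (-(c * A s)))) s := fun s =>
    (hu s).mul (((hG s).const_mul c).neg.exp)
  have hconst := constant_of_has_deriv_right_zero (a := 0) (b := L)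
    (f := fun s => u s * Real.exp (-(c * G s)))
    (fun s _ => (hh s).continuousAt.continuousWithinAt) (fun s hs => by
      have h1 := (hh s).hasDerivWithinAt (s := Ici s)
      have hs' := Ico_subset_Icc_self hs
      rw [uv s hs', eW s hs'] at h1
      convert h1 using 1; ring)
  intro s hs
  have h2 := hconst s hs
  have hG0 : G 0 = 0 := by simp [G]
  have hGs : G s = ∫ σ in (0 : ℝ)..s, a σ :=
    intervalIntegral.integral_congr (fun x hx => eA x (hsub s hs x hx))
  simp only [uv s hs, uv 0 ⟨le_rfl, hL.le⟩, hG0, mul_zero, neg_zero, Real.exp_zero, mul_one] at h2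
  rw [← hGs, ← h2, mul_assoc, ← Real.exp_add]; simp

/-- If `n = 0` is a solution of `dn/ds = F(s,n)` and `Vt` is a `C^m` inverse
integrating factor vanishing to order at least `m` on `n = 0`, then the leading
coefficient `ṽ(s) = (1/m!) ∂ᵐVt/∂nᵐ(s,0)` satisfies
`ṽ(s) = ṽ(0) exp((1−m) ∫₀ˢ (∂F/∂n)(σ,0) dσ)`; in particular `ṽ(0) ≠ 0` forces
`ṽ(s) ≠ 0` for every `s ∈ [0,L]`. -/
theorem stmt_4
    (L eps : ℝ) (hL : 0 < L) (heps : 0 < eps)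
    (F Vt : ℝ × ℝ → ℝ) (m : ℕ) (hm : 1 ≤ m)
    (hF : ContDiffOn ℝ 1 F (Set.Icc 0 L ×ˢ Set.Ioo (-eps) eps))
    (hF0 : ∀ s ∈ Set.Icc (0 : ℝ) L, F (s, 0) = 0)
    (hVt : ContDiffOn ℝ (m : ℕ∞) Vt (Set.Icc 0 L ×ˢ Set.Ioo (-eps) eps))
    (hpde : ∀ z ∈ Set.Icc (0 : ℝ) L ×ˢ Set.Ioo (-eps) eps,
      fderiv ℝ Vt z (1, 0) + F z * fderiv ℝ Vt z (0, 1)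
        = fderiv ℝ F z (0, 1) * Vt z)
    (hvan : ∀ s ∈ Set.Icc (0 : ℝ) L, ∀ j < m,
      iteratedDeriv j (fun n => Vt (s, n)) 0 = 0)
    (vt : ℝ → ℝ)
    (hvt : ∀ s, vt s = (1 / (Nat.factorial m : ℝ)) *
      iteratedDeriv m (fun n => Vt (s, n)) 0) :
    (∀ s ∈ Set.Icc (0 : ℝ) L,
      vt s = vt 0 * Real.exp ((1 - (m : ℝ)) *
        ∫ σ in (0 : ℝ)..s, fderiv ℝ F (σ, 0) (0, 1)))
    ∧ (vt 0 ≠ 0 → ∀ s ∈ Set.Icc (0 : ℝ) L, vt s ≠ 0) := by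
  obtain ⟨k, rfl⟩ : ∃ k, m = k + 1 := ⟨m - 1, by omega⟩
  have hV : ContDiffOn ℝ ((k + 1 : ℕ) : WithTop ℕ∞) Vt (Icc 0 L ×ˢ Ioo (-eps) eps) := hVt
  have hF1 : ContDiffOn ℝ ((0 + 1 : ℕ) : WithTop ℕ∞) F (Icc 0 L ×ˢ Ioo (-eps) eps) := by
    simpa using hF
  have hPV := pdn_contDiffOn hL hV
  have hPF := pdn_contDiffOn hL hF1
  have h0mem : (0 : ℝ) ∈ Ioo (-eps) eps := ⟨by linarith, heps⟩
  have sl : ∀ {f : ℝ × ℝ → ℝ}, ContinuousOn f (Icc 0 L ×ˢ Ioo (-eps) eps) →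
      ∀ n ∈ Ioo (-eps) eps, ContinuousOn (fun s => f (s, n)) (Icc 0 L) := fun hf n hn =>
    hf.comp (f := fun s : ℝ => (s, n)) (by fun_prop) (fun x hx => ⟨hx, hn⟩)
  have hvc : ContinuousOn vt (Icc 0 L) := by
    refine ContinuousOn.congr ?_ (fun s _ => hvt s)
    exact (sl (iter_cont hL _ Vt hV) 0 h0mem).const_smul (1 / ((k + 1).factorial : ℝ))
  have hac : ContinuousOn (fun s => pdn F (s, 0)) (Icc 0 L) := sl hPF.continuousOn 0 h0mem
  obtain ⟨C1, hC1, b1, t1⟩ := quotQ hL heps hV hvan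
  obtain ⟨C2, hC2, b2, t2⟩ := quotQ hL heps hPV (fun s hs j hj => by
    have := hvan s hs (j + 1) (by omega)
    rw [iteratedDeriv_succ'] at this
    exact this)
  obtain ⟨C3, hC3, b3, t3⟩ := quotQ hL heps hF1 (fun s hs j hj => by
    obtain rfl : j = 0 := by omega
    simpa using hF0 s hs)
  obtain ⟨C4, hC4, b4, t4⟩ := quotQ hL heps hPF (fun s hs j hj => by omega)
  -- differentiability at interior points
  have hnb : ∀ s ∈ Ioo 0 L, ∀ n ∈ Ioo (-eps) eps,
      Icc 0 L ×ˢ Ioo (-eps) eps ∈ 𝓝 (s, n) := fun s hs n hn =>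
    prod_mem_nhds (Icc_mem_nhds hs.1 hs.2) (isOpen_Ioo.mem_nhds hn)
  have fdn : ∀ {f : ℝ × ℝ → ℝ}, DifferentiableOn ℝ f (Icc 0 L ×ˢ Ioo (-eps) eps) →
      ∀ s ∈ Ioo 0 L, ∀ n ∈ Ioo (-eps) eps, fderiv ℝ f (s, n) (0, 1) = pdn f (s, n) := by
    intro f hf s hs n hn
    have := (sliceHas (Ioo_subset_Icc_self hs) hn (hf _ ⟨Ioo_subset_Icc_self hs, hn⟩)).deriv
    rw [fderivWithin_of_mem_nhds (hnb s hs n hn)] at this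
    exact this.symm
  have hVd := hV.differentiableOn (by simp)
  have hFd := hF1.differentiableOn (by simp)
  have hFTC : ∀ n ∈ Ioo (-eps) eps, ∀ s ∈ Icc 0 L, Vt (s, n) - Vt (0, n) =
      ∫ σ in (0 : ℝ)..s, (pdn F (σ, n) * Vt (σ, n) - F (σ, n) * pdn Vt (σ, n)) := by
    intro n hn s hs
    have hsub : Icc 0 s ⊆ Icc 0 L := Icc_subset_Icc_right hs.2
    symm
    refine intervalIntegral.integral_eq_sub_of_hasDerivAt_of_le (f := fun s => Vt (s, n)) hs.1
      ((sl hV.continuousOn n hn).mono hsub) ?_ ?_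
    · intro x hx
      have hx' : x ∈ Ioo 0 L := ⟨hx.1, hx.2.trans_le hs.2⟩
      have hd := (hVd.differentiableAt (hnb x hx' n hn)).hasFDerivAt
      have h1 : HasDerivAt (fun x : ℝ => (x, n)) ((1 : ℝ), (0 : ℝ)) x :=
        (hasDerivAt_id x).prodMk (hasDerivAt_const x n)
      have h2 := hd.comp_hasDerivAt x h1
      have h3 := hpde (x, n) ⟨Ioo_subset_Icc_self hx', hn⟩
      rw [fdn hVd x hx' n hn, fdn hFd x hx' n hn] at h3
      rw [← eq_sub_iff_add_eq] at h3
      rw [← h3]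
      exact h2
    · apply ContinuousOn.intervalIntegrable
      rw [uIcc_of_le hs.1]
      exact (((sl hPF.continuousOn n hn).mul (sl hV.continuousOn n hn)).sub
        ((sl hF1.continuousOn n hn).mul (sl hPV.continuousOn n hn))).mono hsub
  have hint : ∀ s ∈ Icc 0 L, vt s - vt 0 =
      ∫ σ in (0 : ℝ)..s, (1 - ((k + 1 : ℕ) : ℝ)) * (pdn F (σ, 0) * vt σ) := by
    intro s hs
    have hev : ∀ᶠ n in 𝓝[>] (0 : ℝ), n ∈ Ioc 0 (eps / 2) := Ioc_mem_nhdsGT (by linarith)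
    have hmem : ∀ n ∈ Ioc 0 (eps / 2), n ∈ Ioo (-eps) eps := fun n hn =>
      ⟨by linarith [hn.1], by linarith [hn.2]⟩
    have L1 : Tendsto (fun n => Vt (s, n) / n ^ (k + 1) - Vt (0, n) / n ^ (k + 1)) (𝓝[>] 0)
        (𝓝 (vt s - vt 0)) := by
      rw [hvt s, hvt 0]
      exact (t1 s hs).sub (t1 0 ⟨le_rfl, hL.le⟩)
    have L2 : Tendsto (fun n => ∫ σ in (0 : ℝ)..s,
        (pdn F (σ, n) / n ^ 0 * (Vt (σ, n) / n ^ (k + 1)) -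
          F (σ, n) / n ^ (0 + 1) * (pdn Vt (σ, n) / n ^ k))) (𝓝[>] 0)
        (𝓝 (∫ σ in (0 : ℝ)..s, (1 - ((k + 1 : ℕ) : ℝ)) * (pdn F (σ, 0) * vt σ))) := by
      have hsub : ∀ x ∈ uIoc 0 s, x ∈ Icc 0 L := fun x hx => by
        rw [uIoc_of_le hs.1] at hx; exact ⟨hx.1.le, hx.2.trans hs.2⟩
      refine intervalIntegral.tendsto_integral_filter_of_dominated_convergence
        (fun _ => C4 * C1 + C3 * C2) ?_ ?_ ?_ ?_
      · filter_upwards [hev] with n hn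
        have hn' := hmem n hn
        refine ContinuousOn.aestronglyMeasurable ?_ measurableSet_uIoc
        exact ((((sl hPF.continuousOn n hn').div_const _).mul
          ((sl hV.continuousOn n hn').div_const _)).sub
          (((sl hF1.continuousOn n hn').div_const _).mul
          ((sl hPV.continuousOn n hn').div_const _))).mono hsub
      · filter_upwards [hev] with n hn
        refine Eventually.of_forall (fun x hx => ?_)
        have hx' := hsub x hx
        rw [Real.norm_eq_abs]
        refine (abs_sub _ _).trans ?_
        rw [abs_mul, abs_mul]
        exact add_le_add (mul_le_mul (b4 x hx' n hn) (b1 x hx' n hn) (abs_nonneg _) hC4)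
          (mul_le_mul (b3 x hx' n hn) (b2 x hx' n hn) (abs_nonneg _) hC3)
      · exact intervalIntegrable_const
      · refine Eventually.of_forall (fun x hx => ?_)
        have hx' := hsub x hx
        convert ((t4 x hx').mul (t1 x hx')).sub ((t3 x hx').mul (t2 x hx')) using 2
        rw [hvt x]
        have e1 : iteratedDeriv k (fun n => pdn Vt (x, n)) 0 =
            iteratedDeriv (k + 1) (fun n => Vt (x, n)) 0 := by
          rw [iteratedDeriv_succ']; rfl
        have e2 : iteratedDeriv (0 + 1) (fun n => F (x, n)) 0 = pdn F (x, 0) := by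
          simp [pdn, iteratedDeriv_one]
        rw [e1, e2, iteratedDeriv_zero, Nat.factorial_succ]
        have : (k.factorial : ℝ) ≠ 0 := by positivity
        have : (k : ℝ) + 1 ≠ 0 := by positivity
        simp only [Nat.factorial]
        push_cast
        field_simp
    refine tendsto_nhds_unique L1 (L2.congr' ?_)
    filter_upwards [hev] with n hn
    rw [← sub_div, hFTC n (hmem n hn) s hs, ← intervalIntegral.integral_div]
    congr 1
    ext σ
    have := hn.1.ne'
    field_simp
    ring
  have main := odeLem hL hac hvc hint
  have hE : ∀ s ∈ Icc (0 : ℝ) L,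
      vt s = vt 0 * Real.exp ((1 - ((k + 1 : ℕ) : ℝ)) *
        ∫ σ in (0 : ℝ)..s, fderiv ℝ F (σ, 0) (0, 1)) := by
    intro s hs
    rw [main s hs]
    congr 3
    rw [intervalIntegral.integral_of_le hs.1, intervalIntegral.integral_of_le hs.1,
      MeasureTheory.integral_Ioc_eq_integral_Ioo, MeasureTheory.integral_Ioc_eq_integral_Ioo]
    refine MeasureTheory.setIntegral_congr_fun measurableSet_Ioo (fun x hx => ?_)
    exact (fdn hFd x ⟨hx.1, hx.2.trans_le hs.2⟩ 0 h0mem).symm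
  refine ⟨hE, fun h0 s hs => ?_⟩
  rw [hE s hs]
  exact mul_ne_zero h0 (Real.exp_ne_zero _)
end

section
/- Let ν and Π be real functions analytic in a neighborhood of 0 ∈ ℝ with Π(0) = 0, and suppose the functional equation ν(Π(σ)) = ν(σ) · Π'(σ) holds for all σ in a neighborhood of 0. If ν(0) ≠ 0, then Π(σ) = σ for all σ in a neighborhood of 0. -/
/-- If `ν` and `Pi` are analytic near `0`, `Pi 0 = 0`, they satisfy the
functional equation `ν (Pi σ) = ν σ · Pi' σ` near `0`, and `ν 0 ≠ 0`, then
`Pi` is the identity near `0`. -/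
theorem stmt_5
    (ν Pi : ℝ → ℝ)
    (hν : AnalyticAt ℝ ν 0) (hPi : AnalyticAt ℝ Pi 0)
    (hPi0 : Pi 0 = 0)
    (heq : ∀ᶠ σ in nhds (0 : ℝ), ν (Pi σ) = ν σ * deriv Pi σ)
    (hν0 : ν 0 ≠ 0) :
    ∀ᶠ σ in nhds (0 : ℝ), Pi σ = σ := by
  have h1 : ∀ᶠ x in nhds (0 : ℝ), AnalyticAt ℝ ν x ∧ ν x ≠ 0 :=
    hν.eventually_analyticAt.and (hν.continuousAt.eventually_ne hν0)
  obtain ⟨r, hr, hball⟩ := Metric.eventually_nhds_iff_ball.1 h1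
  have hcont : ContinuousOn (fun x => (ν x)⁻¹) (Metric.ball 0 r) := fun x hx =>
    ((hball x hx).1.continuousAt.inv₀ (hball x hx).2).continuousWithinAt
  have hF : ∀ x ∈ Metric.ball (0 : ℝ) r,
      HasStrictDerivAt (fun y => ∫ t in (0 : ℝ)..y, (ν t)⁻¹) (ν x)⁻¹ x := by
    intro x hx
    apply intervalIntegral.integral_hasStrictDerivAt_right
    · apply ContinuousOn.intervalIntegrable
      apply hcont.mono
      exact (convex_ball (0 : ℝ) r).ordConnected.uIcc_subset (Metric.mem_ball_self hr) hx
    · exact hcont.stronglyMeasurableAtFilter Metric.isOpen_ball x hx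
    · exact hcont.continuousAt (Metric.isOpen_ball.mem_nhds hx)
  generalize (fun y => ∫ t in (0 : ℝ)..y, (ν t)⁻¹) = F at hF
  have hT : Filter.Tendsto Pi (nhds 0) (nhds 0) := by
    simpa [ContinuousAt, hPi0] using hPi.continuousAt
  have h2 := (hT.eventually (Metric.ball_mem_nhds (0 : ℝ) hr)).and
    (heq.and (hPi.eventually_analyticAt.and (Metric.ball_mem_nhds (0 : ℝ) hr)))
  obtain ⟨s, hs, hb⟩ := Metric.eventually_nhds_iff_ball.1 h2
  have hd : ∀ x ∈ Metric.ball (0 : ℝ) s, HasDerivAt (fun y => F (Pi y)) (ν x)⁻¹ x := by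
    intro x hx
    obtain ⟨a, b, c, d⟩ := hb x hx
    have := (hF _ a).hasDerivAt.comp x c.differentiableAt.hasDerivAt
    refine this.congr_deriv ?_
    have hn := (hball _ a).2
    have hn' := (hball _ d).2
    rw [inv_mul_eq_iff_eq_mul₀ hn, b]
    field_simp
  have hE : Set.EqOn (fun y => F (Pi y)) F (Metric.ball 0 s) := by
    apply Metric.isOpen_ball.eqOn_of_deriv_eq (convex_ball (0 : ℝ) s).isPreconnected (𝕜 := ℝ)
      (x := 0)
    · exact fun x hx => (hd x hx).differentiableAt.differentiableWithinAt
    · exact fun x hx => (hF x (hb x hx).2.2.2).hasDerivAt.differentiableAt.differentiableWithinAt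
    · exact fun x hx => by rw [(hd x hx).deriv, (hF x (hb x hx).2.2.2).hasDerivAt.deriv]
    · exact Metric.mem_ball_self hs
    · simp [hPi0]
  have h0 := hF 0 (Metric.mem_ball_self hr)
  have hL := (h0.hasStrictFDerivAt_equiv (inv_ne_zero hν0)).eventually_left_inverse
  filter_upwards [hL, hT.eventually hL, Metric.ball_mem_nhds (0 : ℝ) hs] with x a b c
  have e : F (Pi x) = F x := hE c
  rw [← b, e, a]
end

section
/- Let ν and Π be real functions analytic in a neighborhood of 0 ∈ ℝ, with Π(0) = 0 and Π'(0) = 1, satisfying ν(Π(σ)) = ν(σ) · Π'(σ) near 0. Assume ν is not identically zero and vanishes at 0 to exact order m ≥ 1 (i.e. ν(σ) = ν_m σ^m + O(σ^{m+1}) with ν_m ≠ 0), and assume Π is not the identity, so there is a smallest integer k > 1 with Π(σ) = σ + β_k σ^k + O(σ^{k+1}), β_k ≠ 0. Then k = m. -/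
/-- If `ν (Pi σ) = ν σ · Pi' σ` near `0`, `ν` vanishes at `0` to exact order
`m ≥ 1` and `Pi` is tangent to the identity with first nonlinear term of exact
order `k > 1`, then `k = m`. -/
theorem stmt_6
    (ν Pi : ℝ → ℝ) (m k : ℕ)
    (hν : AnalyticAt ℝ ν 0) (hPi : AnalyticAt ℝ Pi 0)
    (hPi0 : Pi 0 = 0) (hPi1 : deriv Pi 0 = 1)
    (heq : ∀ᶠ σ in nhds (0 : ℝ), ν (Pi σ) = ν σ * deriv Pi σ)
    (hm : 1 ≤ m)
    (hνvan : ∀ j < m, iteratedDeriv j ν 0 = 0)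
    (hνm : iteratedDeriv m ν 0 ≠ 0)
    (hk : 1 < k)
    (hkvan : ∀ j < k, iteratedDeriv j (fun σ => Pi σ - σ) 0 = 0)
    (hkne : iteratedDeriv k (fun σ => Pi σ - σ) 0 ≠ 0) :
    k = m := by
  obtain ⟨n, rfl⟩ : ∃ n, k = n + 1 := ⟨k - 1, by omega⟩
  have hn : n ≠ 0 := by omega
  have hd : AnalyticAt ℝ (fun σ => Pi σ - σ) 0 := hPi.fun_sub analyticAt_id
  obtain ⟨g, hg, hg0, hgeq⟩ := hν.analyticOrderAt_eq_natCast.1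
    ((analyticOrderAt_eq_nat_iff_iteratedDeriv_eq_zero hν).2 ⟨hνvan, hνm⟩)
  obtain ⟨h, hh, hh0, hheq⟩ := hd.analyticOrderAt_eq_natCast.1
    ((analyticOrderAt_eq_nat_iff_iteratedDeriv_eq_zero hd).2 ⟨hkvan, hkne⟩)
  simp only [sub_zero, smul_eq_mul] at hgeq hheq
  have hPt : Filter.Tendsto Pi (nhds 0) (nhds 0) := by
    simpa [hPi0] using hPi.continuousAt.tendsto
  have hgP : Filter.Tendsto (fun σ => g (Pi σ)) (nhds 0) (nhds (g 0)) :=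
    hg.continuousAt.tendsto.comp hPt
  have hder : ∀ᶠ σ in nhds (0 : ℝ),
      deriv Pi σ = 1 + ((n + 1 : ℝ) * σ ^ n * h σ + σ ^ (n + 1) * deriv h σ) := by
    filter_upwards [hheq.eventually_nhds, hh.eventually_analyticAt] with σ h1 h2
    have h3 : HasDerivAt (fun x => x + x ^ (n + 1) * h x)
        (1 + ((n + 1 : ℝ) * σ ^ n * h σ + σ ^ (n + 1) * deriv h σ)) σ := by
      have := (hasDerivAt_id σ).fun_add
        ((hasDerivAt_pow (n + 1) σ).fun_mul h2.differentiableAt.hasDerivAt)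
      simpa using this
    refine (h3.congr_of_eventuallyEq ?_).deriv
    filter_upwards [h1] with x hx
    linarith
  have hO : (fun σ => g (Pi σ) - g σ) =O[nhds 0] fun σ => Pi σ - σ :=
    hg.hasStrictFDerivAt.isBigO_sub.comp_tendsto
      (k := fun σ : ℝ => (Pi σ, σ)) (hPt.prodMk_nhds Filter.tendsto_id)
  obtain ⟨C, hC⟩ := hO.bound
  let E : ℝ → ℝ := fun σ => g σ * ((n + 1 : ℝ) * h σ + σ * deriv h σ)
    - h σ * (∑ i ∈ Finset.range m, (1 + σ ^ n * h σ) ^ i) * g (Pi σ)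
  have hE : Filter.Tendsto E (nhds 0) (nhds (g 0 * ((n + 1 : ℝ) * h 0 + 0 * deriv h 0)
    - h 0 * (∑ i ∈ Finset.range m, (1 + 0 ^ n * h 0) ^ i) * g 0)) := by
    have c1 : Filter.Tendsto g (nhds 0) (nhds (g 0)) := hg.continuousAt
    have c2 : Filter.Tendsto h (nhds 0) (nhds (h 0)) := hh.continuousAt
    have c3 : Filter.Tendsto (deriv h) (nhds 0) (nhds (deriv h 0)) := hh.deriv.continuousAt
    have c4 : Filter.Tendsto (fun x : ℝ => x) (nhds 0) (nhds 0) := Filter.tendsto_id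
    exact (c1.mul ((c2.const_mul _).add (c4.mul c3))).sub
      ((c2.mul (tendsto_finsetSum _ fun i _ =>
        (((c4.pow n).mul c2).const_add 1).pow i)).mul hgP)
  have hb : ∀ᶠ σ in nhdsWithin (0 : ℝ) {0}ᶜ, |E σ| ≤ C * |σ * h σ| := by
    have hgeqP := hPt.eventually hgeq
    filter_upwards [nhdsWithin_le_nhds hgeq, nhdsWithin_le_nhds hgeqP,
      nhdsWithin_le_nhds hheq, nhdsWithin_le_nhds hder, nhdsWithin_le_nhds hC,
      nhdsWithin_le_nhds heq, self_mem_nhdsWithin] with σ a1 a2 a3 a4 a5 a6 a7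
    have hσ : σ ≠ 0 := a7
    have hP : Pi σ = σ * (1 + σ ^ n * h σ) := by linear_combination a3
    have key : (1 + σ ^ n * h σ) ^ m * g (Pi σ)
        = g σ * (1 + ((n + 1 : ℝ) * σ ^ n * h σ + σ ^ (n + 1) * deriv h σ)) := by
      rw [a2, a1, a4] at a6
      have e : Pi σ ^ m = σ ^ m * (1 + σ ^ n * h σ) ^ m := by rw [hP, mul_pow]
      rw [e] at a6
      apply mul_left_cancel₀ (pow_ne_zero m hσ)
      linear_combination a6
    have gs := geom_sum_mul (1 + σ ^ n * h σ) m
    have hEq : σ ^ n * E σ = g (Pi σ) - g σ := by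
      simp only [E]
      linear_combination (-g (Pi σ)) * gs - key
    rw [← hEq, a3, Real.norm_eq_abs, Real.norm_eq_abs,
      show σ ^ (n + 1) * h σ = σ ^ n * (σ * h σ) by ring, abs_mul, abs_mul (σ ^ n)] at a5
    have hp : 0 < |σ ^ n| := abs_pos.2 (pow_ne_zero n hσ)
    refine le_of_mul_le_mul_left ?_ hp
    linarith
  have hR : Filter.Tendsto (fun σ => C * |σ * h σ|) (nhds 0) (nhds (C * |0 * h 0|)) :=
    (((Filter.tendsto_id (x := nhds (0 : ℝ))).mul hh.continuousAt.tendsto).abs).const_mul C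
  have hle := le_of_tendsto_of_tendsto (hE.abs.mono_left nhdsWithin_le_nhds)
    (hR.mono_left nhdsWithin_le_nhds) hb
  simp only [zero_mul, abs_zero, mul_zero, zero_pow hn, add_zero, one_pow, Finset.sum_const,
    Finset.card_range, nsmul_eq_mul, mul_one] at hle
  have h0 := abs_eq_zero.1 (le_antisymm hle (abs_nonneg _))
  have h1 : (g 0 * h 0) * ((n + 1 : ℝ) - m) = 0 := by linear_combination h0
  have h2 := (mul_eq_zero.1 h1).resolve_left (mul_ne_zero hg0 hh0)
  have h3 : ((n + 1 : ℕ) : ℝ) = m := by push_cast; linarith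
  exact_mod_cast h3
end

section
/- Let ρ > 1 be a real number that is not a natural number, let w be real analytic in a neighborhood of 0 with w(0) ≠ 0, and set ν(σ) = σ^ρ w(σ) for σ > 0 small. Let Π be real analytic in a neighborhood of 0 with Π(0) = 0 and Π(σ) > 0 for small σ > 0, and suppose ν(Π(σ)) = ν(σ) · Π'(σ) for all small σ > 0. Then Π(σ) = σ for all σ in a neighborhood of 0. -/
open Filter Topology

lemma aux_fact (f : ℝ → ℝ) (hf : AnalyticAt ℝ f 0)
    (hne : ¬ ∀ᶠ z in 𝓝 (0:ℝ), f z = 0) :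
    ∃ (k : ℕ) (g : ℝ → ℝ), AnalyticAt ℝ g 0 ∧ g 0 ≠ 0 ∧ ∀ᶠ z in 𝓝 (0:ℝ), f z = z ^ k * g z := by
  obtain ⟨n, g, h1, h2, h3⟩ := hf.exists_eventuallyEq_pow_smul_nonzero_iff.2 hne
  exact ⟨n, g, h1, h2, by simpa using h3⟩

lemma aux_deriv (f g : ℝ → ℝ) (k : ℕ) (hg : AnalyticAt ℝ g 0)
    (h : ∀ᶠ z in 𝓝 (0:ℝ), f z = z ^ k * g z) :
    ∀ᶠ z in 𝓝 (0:ℝ), deriv f z = k * z ^ (k-1) * g z + z ^ k * deriv g z := by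
  have h' : f =ᶠ[𝓝 0] fun z => z ^ k * g z := h
  filter_upwards [h'.deriv, hg.eventually_analyticAt] with z hz hgz
  rw [hz]
  exact ((hasDerivAt_pow k z).mul hgz.differentiableAt.hasDerivAt).deriv

lemma aux_step2 (ρ : ℝ) (hρn : ∀ n : ℕ, ρ ≠ n) (w Pi g : ℝ → ℝ)
    (hw : AnalyticAt ℝ w 0) (hw0 : w 0 ≠ 0) (hPi : AnalyticAt ℝ Pi 0) (hPi0 : Pi 0 = 0)
    (hg : AnalyticAt ℝ g 0) (hg1 : g 0 = 1) (hP : ∀ᶠ z in 𝓝 (0:ℝ), Pi z = z * g z)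
    (heq : ∀ᶠ z in 𝓝[>] (0:ℝ), g z ^ ρ * w (Pi z) = w z * (g z + z * deriv g z)) :
    ∀ᶠ z in 𝓝 (0:ℝ), g z - 1 = 0 := by
  by_contra hne
  have hg1a : AnalyticAt ℝ (fun z => g z - 1) 0 := hg.sub analyticAt_const
  obtain ⟨j, h, hh, hh0, hj⟩ := aux_fact _ hg1a hne
  have hj0 : j ≠ 0 := by
    rintro rfl
    have := hj.self_of_nhds
    simp [hg1] at this
    exact hh0 this.symm
  have hd := aux_deriv _ h j hh hj
  simp only [deriv_sub_const] at hd
  have hle : 𝓝[>] (0:ℝ) ≤ 𝓝 0 := nhdsWithin_le_nhds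
  -- dslope
  have hφ : ContinuousAt (dslope (fun x : ℝ => x ^ ρ) 1) 1 := by
    apply continuousAt_dslope_same.2
    exact (Real.hasDerivAt_rpow_const (Or.inl one_ne_zero)).differentiableAt
  have hφ1 : dslope (fun x : ℝ => x ^ ρ) 1 1 = ρ := by
    rw [dslope_same, (Real.hasDerivAt_rpow_const (Or.inl one_ne_zero)).deriv]
    simp
  have tg : Tendsto g (𝓝[>] 0) (𝓝 1) := by
    rw [← hg1]; exact hg.continuousAt.tendsto.mono_left hle
  have tφ : Tendsto (fun z => dslope (fun x : ℝ => x ^ ρ) 1 (g z)) (𝓝[>] 0) (𝓝 ρ) := by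
    have := hφ.tendsto.comp tg
    rwa [hφ1] at this
  have th : Tendsto h (𝓝[>] 0) (𝓝 (h 0)) := hh.continuousAt.tendsto.mono_left hle
  have th' : Tendsto (deriv h) (𝓝[>] 0) (𝓝 (deriv h 0)) :=
    hh.deriv.continuousAt.tendsto.mono_left hle
  have tw : Tendsto w (𝓝[>] 0) (𝓝 (w 0)) := hw.continuousAt.tendsto.mono_left hle
  have tid : Tendsto (fun z : ℝ => z) (𝓝[>] 0) (𝓝 0) := tendsto_id.mono_left hle
  have tP0 : Tendsto Pi (𝓝[>] 0) (𝓝 0) := by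
    have := hPi.continuousAt.tendsto.mono_left hle
    rwa [hPi0] at this
  have twP : Tendsto (fun z => w (Pi z)) (𝓝[>] 0) (𝓝 (w 0)) :=
    hw.continuousAt.tendsto.comp tP0
  -- quotient
  have hO : (fun z => w (Pi z) - w z) =O[𝓝[>] 0] (fun z => Pi z - z) := by
    have := hw.hasStrictFDerivAt.isBigO_sub
    exact this.comp_tendsto (tP0.prodMk_nhds tid)
  have tq : Tendsto (fun z => (w (Pi z) - w z) / z ^ j) (𝓝[>] 0) (𝓝 0) := by
    apply Asymptotics.IsLittleO.tendsto_div_nhds_zero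
    refine hO.trans_isLittleO ?_
    have : (fun z => z * h z * z ^ j) =o[𝓝[>] 0] (fun z : ℝ => 1 * z ^ j) := by
      refine Asymptotics.IsLittleO.mul_isBigO ?_ (Asymptotics.isBigO_refl _ _)
      rw [Asymptotics.isLittleO_one_iff]
      simpa using tid.mul th
    simp only [one_mul] at this
    refine this.congr' ?_ EventuallyEq.rfl
    filter_upwards [hle hj, hle hP] with z h1 h2
    rw [h2]
    linear_combination (-z) * h1
  have e1 := ((tφ.mul th).mul twP).add tq
  have e2 := tw.mul ((th.add (th.const_mul (j:ℝ))).add (tid.mul th'))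
  have : (fun z => dslope (fun x : ℝ => x ^ ρ) 1 (g z) * h z * w (Pi z) + (w (Pi z) - w z) / z ^ j)
      =ᶠ[𝓝[>] 0] fun z => w z * (h z + j * h z + z * deriv h z) := by
    filter_upwards [hle hj, hle hd, heq, self_mem_nhdsWithin] with z h1 h2 h3 hz
    have hz : (0:ℝ) < z := hz
    have hs := sub_smul_dslope (fun x : ℝ => x ^ ρ) 1 (g z)
    simp only [smul_eq_mul, Real.one_rpow] at hs
    have hzj : z ^ j ≠ 0 := by positivity
    have hzz : z * z ^ (j-1) = z ^ j := by
      rw [← pow_succ', Nat.sub_add_cancel (Nat.one_le_iff_ne_zero.2 hj0)]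
    apply mul_left_cancel₀ hzj
    rw [mul_add, mul_div_cancel₀ _ hzj]
    rw [h2] at h3
    rw [h1] at hs
    linear_combination w (Pi z) * hs + h3 + w z * h1 + w z * j * h z * hzz
  have key := tendsto_nhds_unique (e1.congr' this) e2
  have : ρ = ((j + 1 : ℕ) : ℝ) := by
    have : (ρ - (j+1)) * (w 0 * h 0) = 0 := by linear_combination key
    have h2 := (mul_eq_zero.1 this).resolve_right (mul_ne_zero hw0 hh0)
    push_cast; linarith
  exact hρn _ this


/-- If `ν σ = σ^ρ w σ` with `ρ > 1` not a natural number and `w` analytic with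
`w 0 ≠ 0`, and the Poincaré-type functional equation
`ν (Pi σ) = ν σ · Pi' σ` holds for small `σ > 0`, with `Pi` analytic,
`Pi 0 = 0` and `Pi σ > 0` for small `σ > 0`, then `Pi` is the identity near
`0`. -/
theorem stmt_8
    (ρ : ℝ) (hρ : 1 < ρ) (hρn : ∀ n : ℕ, ρ ≠ n)
    (w Pi : ℝ → ℝ)
    (hw : AnalyticAt ℝ w 0) (hw0 : w 0 ≠ 0)
    (hPi : AnalyticAt ℝ Pi 0) (hPi0 : Pi 0 = 0)
    (hPipos : ∀ᶠ σ in nhdsWithin (0 : ℝ) (Set.Ioi 0), 0 < Pi σ)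
    (heq : ∀ᶠ σ in nhdsWithin (0 : ℝ) (Set.Ioi 0),
      Pi σ ^ ρ * w (Pi σ) = σ ^ ρ * w σ * deriv Pi σ) :
    ∀ᶠ σ in nhds (0 : ℝ), Pi σ = σ := by

  have hle : 𝓝[>] (0:ℝ) ≤ 𝓝 0 := nhdsWithin_le_nhds
  have hne : ¬ ∀ᶠ z in 𝓝 (0:ℝ), Pi z = 0 := by
    intro h
    obtain ⟨z, h1, h2⟩ := ((h.filter_mono hle).and hPipos).exists
    exact h2.ne' h1
  obtain ⟨k, g, hg, hg0, hk⟩ := aux_fact Pi hPi hne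
  have hk0 : k ≠ 0 := by
    rintro rfl
    have := hk.self_of_nhds
    simp [hPi0] at this
    exact hg0 this.symm
  have hd := aux_deriv _ g k hg hk
  have tg : Tendsto g (𝓝[>] 0) (𝓝 (g 0)) := hg.continuousAt.tendsto.mono_left hle
  have tg' : Tendsto (deriv g) (𝓝[>] 0) (𝓝 (deriv g 0)) :=
    hg.deriv.continuousAt.tendsto.mono_left hle
  have tw : Tendsto w (𝓝[>] 0) (𝓝 (w 0)) := hw.continuousAt.tendsto.mono_left hle
  have tid : Tendsto (fun z : ℝ => z) (𝓝[>] 0) (𝓝 0) := tendsto_id.mono_left hle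
  have tP0 : Tendsto Pi (𝓝[>] 0) (𝓝 0) := by
    have := hPi.continuousAt.tendsto.mono_left hle
    rwa [hPi0] at this
  have twP : Tendsto (fun z => w (Pi z)) (𝓝[>] 0) (𝓝 (w 0)) :=
    hw.continuousAt.tendsto.comp tP0
  have hgpos : ∀ᶠ z in 𝓝[>] (0:ℝ), 0 < g z := by
    filter_upwards [hle hk, hPipos, self_mem_nhdsWithin] with z h1 h2 hz
    have hz : (0:ℝ) < z := hz
    rw [h1] at h2
    exact pos_of_mul_pos_right h2 (by positivity)
  have hg0pos : 0 < g 0 :=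
    lt_of_le_of_ne (ge_of_tendsto tg (hgpos.mono fun _ h => h.le)) hg0.symm
  have tgρ : Tendsto (fun z => g z ^ ρ) (𝓝[>] 0) (𝓝 (g 0 ^ ρ)) :=
    tg.rpow_const (Or.inl hg0)
  have heq2 : ∀ᶠ z in 𝓝[>] (0:ℝ), z ^ (((k:ℝ) - 1) * (ρ - 1)) * (g z ^ ρ * w (Pi z))
      = w z * (k * g z + z * deriv g z) := by
    filter_upwards [hle hk, hle hd, heq, hgpos, self_mem_nhdsWithin] with z h1 h2 h3 h4 hz
    have hz : (0:ℝ) < z := hz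
    have hzz : z * z ^ (k-1) = z ^ k := by
      rw [← pow_succ', Nat.sub_add_cancel (Nat.one_le_iff_ne_zero.2 hk0)]
    have hA : Pi z ^ ρ = z ^ ρ * z ^ (k-1) * z ^ (((k:ℝ) - 1) * (ρ - 1)) * g z ^ ρ := by
      rw [h1, Real.mul_rpow (by positivity) h4.le, ← Real.rpow_natCast, ← Real.rpow_natCast,
        ← Real.rpow_mul hz.le, ← Real.rpow_add hz, ← Real.rpow_add hz]
      congr 2
      rw [Nat.cast_sub (Nat.one_le_iff_ne_zero.2 hk0)]
      push_cast; ring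
    have hne : z ^ ρ * z ^ (k-1) ≠ 0 := by positivity
    apply mul_left_cancel₀ hne
    rw [hA, h2] at h3
    linear_combination h3 - z ^ ρ * w z * deriv g z * hzz
  have e2 := tw.mul ((tg.const_mul (k:ℝ)).add (tid.mul tg'))
  have hk1 : k = 1 := by
    by_contra hk1
    have hk2 : (2:ℝ) ≤ k := by
      have : 2 ≤ k := by omega
      exact_mod_cast this
    have hpos : 0 < ((k:ℝ) - 1) * (ρ - 1) := mul_pos (by linarith) (by linarith)
    have tz : Tendsto (fun z : ℝ => z ^ (((k:ℝ) - 1) * (ρ - 1))) (𝓝[>] 0) (𝓝 0) := by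
      have := tid.rpow_const (p := ((k:ℝ) - 1) * (ρ - 1)) (Or.inr hpos.le)
      rwa [Real.zero_rpow hpos.ne'] at this
    have key := tendsto_nhds_unique ((tz.mul (tgρ.mul twP)).congr' heq2) e2
    have : w 0 * (k * g 0) = 0 := by linear_combination -key
    have hk' : (k:ℝ) ≠ 0 := by linarith
    exact mul_ne_zero hw0 (mul_ne_zero hk' hg0) this
  subst hk1
  simp only [Nat.cast_one, sub_self, zero_mul, Real.rpow_zero, one_mul, pow_one] at heq2 e2 hk
  have key := tendsto_nhds_unique ((tgρ.mul twP).congr' heq2) e2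
  have hg1 : g 0 = 1 := by
    have h1 : g 0 ^ ρ = g 0 := by
      apply mul_right_cancel₀ hw0
      linear_combination key
    have h2 : g 0 ^ (ρ - 1) = 1 := by
      rw [Real.rpow_sub hg0pos, h1, Real.rpow_one, div_self hg0]
    have h3 := (Real.rpow_left_inj hg0pos.le zero_le_one (sub_ne_zero.2 hρ.ne')).1 (h2.trans (Real.one_rpow _).symm)
    exact h3
  have := aux_step2 ρ hρn w Pi g hw hw0 hPi hPi0 hg hg1 hk heq2
  filter_upwards [this, hk] with z h1 h2
  rw [h2]; linear_combination z * h1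
end

section
/- Let U ⊆ ℝ² be a connected open neighborhood of p₀, let P, Q be real analytic on U with P(p₀) = Q(p₀) = 0, and let f₁, f₂, u, K₁, K₂ be real analytic on U with: f₁, f₂, u not identically zero; u(p₀) ≠ 0; P ∂fᵢ/∂x + Q ∂fᵢ/∂y = Kᵢ fᵢ on U for i = 1,2 (so fᵢ = 0 are invariant curves with cofactors Kᵢ). Suppose V = f₁^{m₁} f₂^{m₂} u, with m₁, m₂ nonnegative integers, is an inverse integrating factor of X = P ∂x + Q ∂y on U. Then m₁ K₁(p₀) + m₂ K₂(p₀) = (div X)(p₀). -/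
/-- Cofactor identity: if `V = f₁^{m₁} f₂^{m₂} u` is an inverse integrating
factor, the `fᵢ = 0` are invariant analytic curves with cofactors `Kᵢ`, and
`u(p₀) ≠ 0` at a singular point `p₀`, then
`m₁ K₁(p₀) + m₂ K₂(p₀) = div X (p₀)`. -/
theorem stmt_10
    (U : Set (ℝ × ℝ)) (hU : IsOpen U) (hUc : IsPreconnected U)
    (p₀ : ℝ × ℝ) (hp₀ : p₀ ∈ U)
    (P Q f₁ f₂ u K₁ K₂ : ℝ × ℝ → ℝ) (m₁ m₂ : ℕ)
    (hP : ∀ z ∈ U, AnalyticAt ℝ P z) (hQ : ∀ z ∈ U, AnalyticAt ℝ Q z)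
    (hf₁ : ∀ z ∈ U, AnalyticAt ℝ f₁ z) (hf₂ : ∀ z ∈ U, AnalyticAt ℝ f₂ z)
    (hu : ∀ z ∈ U, AnalyticAt ℝ u z)
    (hK₁ : ∀ z ∈ U, AnalyticAt ℝ K₁ z) (hK₂ : ∀ z ∈ U, AnalyticAt ℝ K₂ z)
    (hP0 : P p₀ = 0) (hQ0 : Q p₀ = 0)
    (hf₁ne : ∃ z ∈ U, f₁ z ≠ 0) (hf₂ne : ∃ z ∈ U, f₂ z ≠ 0)
    (hu0 : u p₀ ≠ 0)
    (hinv₁ : ∀ z ∈ U,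
      P z * fderiv ℝ f₁ z (1, 0) + Q z * fderiv ℝ f₁ z (0, 1) = K₁ z * f₁ z)
    (hinv₂ : ∀ z ∈ U,
      P z * fderiv ℝ f₂ z (1, 0) + Q z * fderiv ℝ f₂ z (0, 1) = K₂ z * f₂ z)
    (hiif : ∀ z ∈ U,
      P z * fderiv ℝ (fun w => f₁ w ^ m₁ * f₂ w ^ m₂ * u w) z (1, 0)
        + Q z * fderiv ℝ (fun w => f₁ w ^ m₁ * f₂ w ^ m₂ * u w) z (0, 1)
        = (f₁ z ^ m₁ * f₂ z ^ m₂ * u z)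
            * (fderiv ℝ P z (1, 0) + fderiv ℝ Q z (0, 1))) :
    (m₁ : ℝ) * K₁ p₀ + (m₂ : ℝ) * K₂ p₀
      = fderiv ℝ P p₀ (1, 0) + fderiv ℝ Q p₀ (0, 1) := by
  have pw : ∀ (m : ℕ) (a : ℝ), (m : ℝ) * a ^ (m - 1) * a = m * a ^ m := by
    intro m a
    cases m with
    | zero => simp
    | succ k => simp [pow_succ, mul_assoc]
  have key : ∀ z ∈ U, f₁ z ^ m₁ * f₂ z ^ m₂ *
      ((m₁ * K₁ z + m₂ * K₂ z - (fderiv ℝ P z (1, 0) + fderiv ℝ Q z (0, 1))) * u z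
        + (P z * fderiv ℝ u z (1, 0) + Q z * fderiv ℝ u z (0, 1))) = 0 := by
    intro z hz
    have h1 := (hf₁ z hz).differentiableAt.hasFDerivAt
    have h2 := (hf₂ z hz).differentiableAt.hasFDerivAt
    have h3 := (hu z hz).differentiableAt.hasFDerivAt
    have h := (((h1.pow m₁).mul (h2.pow m₂)).mul h3).fderiv
    have h' : fderiv ℝ (fun w => f₁ w ^ m₁ * f₂ w ^ m₂ * u w) z = _ := h
    have e := hiif z hz
    rw [h'] at e
    simp only [ContinuousLinearMap.add_apply, ContinuousLinearMap.smul_apply, smul_eq_mul,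
      nsmul_eq_mul, Pi.mul_apply, Pi.pow_apply] at e
    have i1 := hinv₁ z hz
    have i2 := hinv₂ z hz
    have p1 := pw m₁ (f₁ z)
    have p2 := pw m₂ (f₂ z)
    linear_combination e - u z * f₂ z ^ m₂ * (m₁ * f₁ z ^ (m₁ - 1)) * i1
      - u z * f₁ z ^ m₁ * (m₂ * f₂ z ^ (m₂ - 1)) * i2
      - u z * f₂ z ^ m₂ * K₁ z * p1 - u z * f₁ z ^ m₁ * K₂ z * p2
  have cP := (hP p₀ hp₀).fderiv.continuousAt
  have cQ := (hQ p₀ hp₀).fderiv.continuousAt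
  have cu := (hu p₀ hp₀).fderiv.continuousAt
  have cP0 := (hP p₀ hp₀).continuousAt
  have cQ0 := (hQ p₀ hp₀).continuousAt
  have cu0 := (hu p₀ hp₀).continuousAt
  have cK1 := (hK₁ p₀ hp₀).continuousAt
  have cK2 := (hK₂ p₀ hp₀).continuousAt
  have cG : ContinuousAt (fun z =>
      ((m₁ * K₁ z + m₂ * K₂ z - (fderiv ℝ P z (1, 0) + fderiv ℝ Q z (0, 1))) * u z
        + (P z * fderiv ℝ u z (1, 0) + Q z * fderiv ℝ u z (0, 1)))) p₀ := by
    fun_prop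
  by_contra hne
  have hG0 : ((m₁ * K₁ p₀ + m₂ * K₂ p₀ - (fderiv ℝ P p₀ (1, 0) + fderiv ℝ Q p₀ (0, 1))) * u p₀
        + (P p₀ * fderiv ℝ u p₀ (1, 0) + Q p₀ * fderiv ℝ u p₀ (0, 1))) ≠ 0 := by
    rw [hP0, hQ0]
    simpa using ⟨sub_ne_zero.mpr hne, hu0⟩
  have hev : ∀ᶠ z in nhds p₀, z ∈ U ∧ f₁ z * f₂ z = 0 := by
    filter_upwards [cG.eventually_ne hG0, hU.mem_nhds hp₀] with z hz hzU
    refine ⟨hzU, ?_⟩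
    rcases mul_eq_zero.mp (key z hzU) with h | h
    · rcases mul_eq_zero.mp h with h | h
      · simp [eq_zero_of_pow_eq_zero h]
      · simp [eq_zero_of_pow_eq_zero h]
    · exact absurd h hz
  have hnz : ∃ᶠ z in nhds p₀, f₁ z ≠ 0 := by
    intro h
    obtain ⟨w, hw, hw0⟩ := hf₁ne
    have hf : AnalyticOnNhd ℝ f₁ U := hf₁
    exact hw0 (hf.eqOn_zero_of_preconnected_of_eventuallyEq_zero hUc hp₀
      (h.mono fun z hz => not_not.mp hz) hw)
  obtain ⟨z, hz, hzev⟩ := (hnz.and_eventually hev.eventually_nhds).exists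
  have hzU : z ∈ U := hzev.self_of_nhds.1
  obtain ⟨w, hw, hw0⟩ := hf₂ne
  have hf : AnalyticOnNhd ℝ f₂ U := hf₂
  refine hw0 (hf.eqOn_zero_of_preconnected_of_eventuallyEq_zero hUc hzU ?_ hw)
  filter_upwards [hzev, (hf₁ z hzU).continuousAt.eventually_ne hz] with y hy hy1
  exact (mul_eq_zero.mp hy.2).resolve_left hy1
end

section
/- With the hypotheses of the cofactor identity — U ⊆ ℝ² a connected open neighborhood of p₀; P, Q analytic with P(p₀) = Q(p₀) = 0; f₁, f₂, u analytic and not identically zero with u(p₀) ≠ 0; X fᵢ = Kᵢ fᵢ with Kᵢ analytic; V = f₁^{m₁} f₂^{m₂} u an inverse integrating factor of X = P ∂x + Q ∂y with m₁, m₂ nonnegative integers — assume moreover that K₁(p₀) = λ > 0, K₂(p₀) = μ < 0 are the eigenvalues of the saddle, that (div X)(p₀) = λ + μ, and that λ/(−μ) is irrational (nonresonant saddle). Then m₁ = m₂ = 1. -/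
/-- At a nonresonant hyperbolic saddle (eigenvalues `λ > 0 > μ` with `λ/(−μ)`
irrational), an analytic inverse integrating factor `V = f₁^{m₁} f₂^{m₂} u`
with `u(p₀) ≠ 0` must have `m₁ = m₂ = 1`. -/
theorem stmt_11
    (U : Set (ℝ × ℝ)) (hU : IsOpen U) (hUc : IsPreconnected U)
    (p₀ : ℝ × ℝ) (hp₀ : p₀ ∈ U)
    (P Q f₁ f₂ u K₁ K₂ : ℝ × ℝ → ℝ) (m₁ m₂ : ℕ)
    (hP : ∀ z ∈ U, AnalyticAt ℝ P z) (hQ : ∀ z ∈ U, AnalyticAt ℝ Q z)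
    (hf₁ : ∀ z ∈ U, AnalyticAt ℝ f₁ z) (hf₂ : ∀ z ∈ U, AnalyticAt ℝ f₂ z)
    (hu : ∀ z ∈ U, AnalyticAt ℝ u z)
    (hK₁ : ∀ z ∈ U, AnalyticAt ℝ K₁ z) (hK₂ : ∀ z ∈ U, AnalyticAt ℝ K₂ z)
    (hP0 : P p₀ = 0) (hQ0 : Q p₀ = 0)
    (hf₁ne : ∃ z ∈ U, f₁ z ≠ 0) (hf₂ne : ∃ z ∈ U, f₂ z ≠ 0)
    (hu0 : u p₀ ≠ 0)
    (hinv₁ : ∀ z ∈ U,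
      P z * fderiv ℝ f₁ z (1, 0) + Q z * fderiv ℝ f₁ z (0, 1) = K₁ z * f₁ z)
    (hinv₂ : ∀ z ∈ U,
      P z * fderiv ℝ f₂ z (1, 0) + Q z * fderiv ℝ f₂ z (0, 1) = K₂ z * f₂ z)
    (hiif : ∀ z ∈ U,
      P z * fderiv ℝ (fun w => f₁ w ^ m₁ * f₂ w ^ m₂ * u w) z (1, 0)
        + Q z * fderiv ℝ (fun w => f₁ w ^ m₁ * f₂ w ^ m₂ * u w) z (0, 1)
        = (f₁ z ^ m₁ * f₂ z ^ m₂ * u z)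
            * (fderiv ℝ P z (1, 0) + fderiv ℝ Q z (0, 1)))
    (lam mu : ℝ) (hlam : 0 < lam) (hmu : mu < 0)
    (hK₁0 : K₁ p₀ = lam) (hK₂0 : K₂ p₀ = mu)
    (hdiv : fderiv ℝ P p₀ (1, 0) + fderiv ℝ Q p₀ (0, 1) = lam + mu)
    (hirr : Irrational (lam / (-mu))) :
    m₁ = 1 ∧ m₂ = 1 := by
  have hf1 : AnalyticOnNhd ℝ f₁ U := hf₁
  have hf2 : AnalyticOnNhd ℝ f₂ U := hf₂
  set G : ℝ × ℝ → ℝ := fun z => u z * (m₁ * K₁ z + m₂ * K₂ z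
      - (fderiv ℝ P z (1, 0) + fderiv ℝ Q z (0, 1)))
      + (P z * fderiv ℝ u z (1, 0) + Q z * fderiv ℝ u z (0, 1)) with hG
  have hmul : ∀ z ∈ U, f₁ z ^ m₁ * f₂ z ^ m₂ * G z = 0 := by
    intro z hz
    have d1 := (hf₁ z hz).differentiableAt.hasFDerivAt
    have d2 := (hf₂ z hz).differentiableAt.hasFDerivAt
    have d3 := (hu z hz).differentiableAt.hasFDerivAt
    have d := ((d1.pow m₁).mul (d2.pow m₂)).mul d3
    have e : fderiv ℝ (fun w => f₁ w ^ m₁ * f₂ w ^ m₂ * u w) z = _ := d.fderiv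
    have h := hiif z hz
    rw [e] at h
    have i1 := hinv₁ z hz
    have i2 := hinv₂ z hz
    have p1 : (m₁ : ℝ) * f₁ z ^ (m₁ - 1) * f₁ z = m₁ * f₁ z ^ m₁ := by
      rcases m₁ with _ | n
      · simp
      · simp [pow_succ, mul_assoc]
    have p2 : (m₂ : ℝ) * f₂ z ^ (m₂ - 1) * f₂ z = m₂ * f₂ z ^ m₂ := by
      rcases m₂ with _ | n
      · simp
      · simp [pow_succ, mul_assoc]
    simp at h
    simp only [hG]
    linear_combination h - u z * f₂ z ^ m₂ * (m₁ * f₁ z ^ (m₁ - 1)) * i1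
      - u z * f₁ z ^ m₁ * (m₂ * f₂ z ^ (m₂ - 1)) * i2
      - u z * f₂ z ^ m₂ * K₁ z * p1 - u z * f₁ z ^ m₁ * K₂ z * p2
  have hGc : ContinuousAt G p₀ := by
    have c : ∀ g : ℝ × ℝ → ℝ, (∀ z ∈ U, AnalyticAt ℝ g z) → ∀ v,
        ContinuousAt (fun z => fderiv ℝ g z v) p₀ := fun g hg v =>
      (hg p₀ hp₀).fderiv.continuousAt.clm_apply continuousAt_const
    have a1 := (hu p₀ hp₀).continuousAt
    have a2 := (hP p₀ hp₀).continuousAt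
    have a3 := (hQ p₀ hp₀).continuousAt
    have a4 := (hK₁ p₀ hp₀).continuousAt
    have a5 := (hK₂ p₀ hp₀).continuousAt
    exact (a1.mul (((continuousAt_const.mul a4).add (continuousAt_const.mul a5)).sub
      ((c P hP _).add (c Q hQ _)))).add ((a2.mul (c u hu _)).add (a3.mul (c u hu _)))
  have hG0 : G p₀ = 0 := by
    by_contra hne
    obtain ⟨z₁, hz₁, hn₁⟩ := hf₁ne
    obtain ⟨z₂, hz₂, hn₂⟩ := hf₂ne
    have ev : (fun z => f₁ z ^ m₁ * f₂ z ^ m₂) =ᶠ[nhds p₀] 0 := by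
      filter_upwards [hGc.eventually_ne hne, hU.mem_nhds hp₀] with z h1 h2
      exact (mul_eq_zero.mp (hmul z h2)).resolve_right h1
    have an : AnalyticOnNhd ℝ (fun z => f₁ z ^ m₁ * f₂ z ^ m₂) U :=
      (hf1.pow m₁).mul (hf2.pow m₂)
    have eq := an.eqOn_zero_of_preconnected_of_eventuallyEq_zero hUc hp₀ ev
    have ev2 : f₂ =ᶠ[nhds z₁] 0 := by
      filter_upwards [(hf₁ z₁ hz₁).continuousAt.eventually_ne hn₁, hU.mem_nhds hz₁] with z h1 h2
      by_contra h3
      exact (pow_ne_zero m₂ h3) ((mul_eq_zero.mp (eq h2)).resolve_left (pow_ne_zero _ h1))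
    exact hn₂ (hf2.eqOn_zero_of_preconnected_of_eventuallyEq_zero hUc hz₁ ev2 hz₂)
  have key : (m₁ : ℝ) * lam + m₂ * mu = lam + mu := by
    simp only [hG, hP0, hQ0, hK₁0, hK₂0, hdiv] at hG0
    have : u p₀ * (m₁ * lam + m₂ * mu - (lam + mu)) = 0 := by linarith
    linarith [(mul_eq_zero.mp this).resolve_left hu0]
  have h1 : m₁ = 1 := by
    by_contra hne
    have hne' : (m₁ : ℝ) - 1 ≠ 0 := sub_ne_zero.mpr (by exact_mod_cast hne)
    apply hirr
    refine ⟨((m₂ : ℚ) - 1) / ((m₁ : ℚ) - 1), ?_⟩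
    push_cast
    rw [div_eq_div_iff hne' (by linarith)]
    linarith
  refine ⟨h1, ?_⟩
  subst h1
  have : ((m₂ : ℝ) - 1) * mu = 0 := by push_cast at key; linarith
  have := (mul_eq_zero.mp this).resolve_right hmu.ne
  have : (m₂ : ℝ) = 1 := by linarith
  exact_mod_cast this
end

section
/- With the hypotheses of the cofactor identity — U ⊆ ℝ² a connected open neighborhood of p₀; P, Q analytic with P(p₀) = Q(p₀) = 0; f₁, f₂, u analytic and not identically zero with u(p₀) ≠ 0; X fᵢ = Kᵢ fᵢ with Kᵢ analytic; V = f₁^{m₁} f₂^{m₂} u an inverse integrating factor of X = P ∂x + Q ∂y with m₁, m₂ nonnegative integers — assume moreover that K₁(p₀) = λ > 0, K₂(p₀) = μ < 0, that (div X)(p₀) = λ + μ ≠ 0, and that −μ/λ = q/p with p, q coprime natural numbers and p ≠ q (a p:q resonant strong saddle). Then there exists a nonnegative integer k with m₁ = 1 + k q and m₂ = 1 + k p. -/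
theorem aux_freq (U : Set (ℝ × ℝ)) (hUc : IsPreconnected U) (f : ℝ × ℝ → ℝ)
    (hf : ∀ z ∈ U, AnalyticAt ℝ f z) (hne : ∃ z ∈ U, f z ≠ 0) (z : ℝ × ℝ) (hz : z ∈ U) :
    ∃ᶠ w in nhds z, f w ≠ 0 := by
  intro h
  obtain ⟨y, hy, hy0⟩ := hne
  have h' : f =ᶠ[nhds z] 0 := by
    filter_upwards [h] with w hw
    simpa using hw
  have hf' : AnalyticOnNhd ℝ f U := hf
  exact hy0 (hf'.eqOn_zero_of_preconnected_of_eventuallyEq_zero hUc hz h' hy)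

theorem aux_pow (m : ℕ) (f : ℝ) : (m : ℝ) * f ^ (m - 1) * f = m * f ^ m := by
  cases m with
  | zero => simp
  | succ k => simp [pow_succ, mul_assoc]

theorem aux_fd (f g u : ℝ × ℝ → ℝ) (m n : ℕ) (z v : ℝ × ℝ)
    (hf : DifferentiableAt ℝ f z) (hg : DifferentiableAt ℝ g z) (hu : DifferentiableAt ℝ u z) :
    fderiv ℝ (fun w => f w ^ m * g w ^ n * u w) z v =
      m * f z ^ (m - 1) * fderiv ℝ f z v * g z ^ n * u z
      + f z ^ m * (n * g z ^ (n - 1) * fderiv ℝ g z v) * u z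
      + f z ^ m * g z ^ n * fderiv ℝ u z v := by
  have h := (((hf.hasFDerivAt.pow m).mul (hg.hasFDerivAt.pow n)).mul hu.hasFDerivAt).fderiv
  have e : (fun w => f w ^ m * g w ^ n * u w) = ((fun x => f x ^ m) * fun x => g x ^ n) * u := rfl
  rw [e, h]
  simp
  ring

/-- At a `p:q` resonant strong hyperbolic saddle (`−μ/λ = q/p`, `p ≠ q`,
`λ + μ ≠ 0`), an analytic inverse integrating factor `V = f₁^{m₁} f₂^{m₂} u`
with `u(p₀) ≠ 0` satisfies `m₁ = 1 + k q`, `m₂ = 1 + k p` for some `k ≥ 0`. -/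
theorem stmt_12
    (U : Set (ℝ × ℝ)) (hU : IsOpen U) (hUc : IsPreconnected U)
    (p₀ : ℝ × ℝ) (hp₀ : p₀ ∈ U)
    (P Q f₁ f₂ u K₁ K₂ : ℝ × ℝ → ℝ) (m₁ m₂ : ℕ)
    (hP : ∀ z ∈ U, AnalyticAt ℝ P z) (hQ : ∀ z ∈ U, AnalyticAt ℝ Q z)
    (hf₁ : ∀ z ∈ U, AnalyticAt ℝ f₁ z) (hf₂ : ∀ z ∈ U, AnalyticAt ℝ f₂ z)
    (hu : ∀ z ∈ U, AnalyticAt ℝ u z)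
    (hK₁ : ∀ z ∈ U, AnalyticAt ℝ K₁ z) (hK₂ : ∀ z ∈ U, AnalyticAt ℝ K₂ z)
    (hP0 : P p₀ = 0) (hQ0 : Q p₀ = 0)
    (hf₁ne : ∃ z ∈ U, f₁ z ≠ 0) (hf₂ne : ∃ z ∈ U, f₂ z ≠ 0)
    (hu0 : u p₀ ≠ 0)
    (hinv₁ : ∀ z ∈ U,
      P z * fderiv ℝ f₁ z (1, 0) + Q z * fderiv ℝ f₁ z (0, 1) = K₁ z * f₁ z)
    (hinv₂ : ∀ z ∈ U,
      P z * fderiv ℝ f₂ z (1, 0) + Q z * fderiv ℝ f₂ z (0, 1) = K₂ z * f₂ z)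
    (hiif : ∀ z ∈ U,
      P z * fderiv ℝ (fun w => f₁ w ^ m₁ * f₂ w ^ m₂ * u w) z (1, 0)
        + Q z * fderiv ℝ (fun w => f₁ w ^ m₁ * f₂ w ^ m₂ * u w) z (0, 1)
        = (f₁ z ^ m₁ * f₂ z ^ m₂ * u z)
            * (fderiv ℝ P z (1, 0) + fderiv ℝ Q z (0, 1)))
    (lam mu : ℝ) (hlam : 0 < lam) (hmu : mu < 0)
    (hK₁0 : K₁ p₀ = lam) (hK₂0 : K₂ p₀ = mu)
    (hdiv : fderiv ℝ P p₀ (1, 0) + fderiv ℝ Q p₀ (0, 1) = lam + mu)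
    (hstrong : lam + mu ≠ 0)
    (p q : ℕ) (hp : 1 ≤ p) (hq : 1 ≤ q) (hcop : Nat.Coprime p q)
    (hpq : p ≠ q) (hres : -mu / lam = (q : ℝ) / (p : ℝ)) :
    ∃ k : ℕ, m₁ = 1 + k * q ∧ m₂ = 1 + k * p := by
  have hfreq : ∃ᶠ z in nhds p₀, f₁ z ≠ 0 ∧ f₂ z ≠ 0 := by
    rw [frequently_nhds_iff]
    intro W hpW hW
    obtain ⟨z, ⟨hz1, hzW⟩, hzU⟩ := ((aux_freq U hUc f₁ hf₁ hf₁ne p₀ hp₀).and_eventually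
      (hW.mem_nhds hpW)).and_eventually (hU.mem_nhds hp₀) |>.exists
    obtain ⟨y, ⟨hy2, hy1⟩, hyW⟩ := ((aux_freq U hUc f₂ hf₂ hf₂ne z hzU).and_eventually
      ((hf₁ z hzU).continuousAt.eventually_ne hz1)).and_eventually (hW.mem_nhds hzW) |>.exists
    exact ⟨y, hyW, hy1, hy2⟩
  let G : ℝ × ℝ → ℝ := fun z => (m₁ * K₁ z + m₂ * K₂ z) * u z
    + (P z * fderiv ℝ u z (1, 0) + Q z * fderiv ℝ u z (0, 1))
    - u z * (fderiv ℝ P z (1, 0) + fderiv ℝ Q z (0, 1))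
  have hGc : ContinuousAt G p₀ := by
    have c1 := (hP p₀ hp₀).continuousAt
    have c2 := (hQ p₀ hp₀).continuousAt
    have c3 := (hu p₀ hp₀).continuousAt
    have c4 := (hK₁ p₀ hp₀).continuousAt
    have c5 := (hK₂ p₀ hp₀).continuousAt
    have d1 := (hP p₀ hp₀).fderiv.continuousAt
    have d2 := (hQ p₀ hp₀).fderiv.continuousAt
    have d3 := (hu p₀ hp₀).fderiv.continuousAt
    have d1' := d1.clm_apply (continuousAt_const (y := ((1, 0) : ℝ × ℝ)))
    have d2' := d2.clm_apply (continuousAt_const (y := ((0, 1) : ℝ × ℝ)))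
    have d3' := d3.clm_apply (continuousAt_const (y := ((1, 0) : ℝ × ℝ)))
    have d4' := d3.clm_apply (continuousAt_const (y := ((0, 1) : ℝ × ℝ)))
    exact ((((continuousAt_const.mul c4).add (continuousAt_const.mul c5)).mul c3).add
      ((c1.mul d3').add (c2.mul d4'))).sub (c3.mul (d1'.add d2'))
  have hG0 : G p₀ = 0 := by
    by_contra hne
    obtain ⟨z, ⟨⟨h1, h2⟩, hGz⟩, hzU⟩ := ((hfreq.and_eventually
      (hGc.eventually_ne hne)).and_eventually (hU.mem_nhds hp₀)).exists
    apply hGz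
    have e := hiif z hzU
    rw [aux_fd _ _ _ _ _ _ _ (hf₁ z hzU).differentiableAt (hf₂ z hzU).differentiableAt
      (hu z hzU).differentiableAt, aux_fd _ _ _ _ _ _ _ (hf₁ z hzU).differentiableAt
      (hf₂ z hzU).differentiableAt (hu z hzU).differentiableAt] at e
    have i1 := hinv₁ z hzU
    have i2 := hinv₂ z hzU
    have w1 := aux_pow m₁ (f₁ z)
    have w2 := aux_pow m₂ (f₂ z)
    have key : f₁ z ^ m₁ * f₂ z ^ m₂ * G z = 0 := by
      simp only [G]
      linear_combination e - m₁ * f₁ z ^ (m₁ - 1) * f₂ z ^ m₂ * u z * i1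
        - m₂ * f₂ z ^ (m₂ - 1) * f₁ z ^ m₁ * u z * i2
        - K₁ z * f₂ z ^ m₂ * u z * w1 - K₂ z * f₁ z ^ m₁ * u z * w2
    exact (mul_eq_zero.mp key).resolve_left (mul_ne_zero (pow_ne_zero _ h1) (pow_ne_zero _ h2))
  have hlin : (m₁ : ℝ) * lam + m₂ * mu = lam + mu := by
    simp only [G, hP0, hQ0, hK₁0, hK₂0, hdiv] at hG0
    apply mul_right_cancel₀ hu0
    linear_combination hG0
  have hp' : (p : ℝ) ≠ 0 := by positivity
  rw [div_eq_div_iff hlam.ne' hp'] at hres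
  have hZ : ((m₁ : ℤ) - 1) * p = ((m₂ : ℤ) - 1) * q := by
    have : ((m₁ : ℝ) - 1) * p = ((m₂ : ℝ) - 1) * q := by
      apply mul_right_cancel₀ hlam.ne'
      linear_combination (p : ℝ) * hlin + ((m₂ : ℝ) - 1) * hres
    exact_mod_cast this
  have hcop' : IsCoprime (q : ℤ) (p : ℤ) := (Nat.isCoprime_iff_coprime.mpr hcop).symm
  obtain ⟨k, hk⟩ : (q : ℤ) ∣ (m₁ : ℤ) - 1 :=
    hcop'.dvd_of_dvd_mul_right ⟨(m₂ : ℤ) - 1, by rw [hZ]; ring⟩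
  have hk2 : (m₂ : ℤ) - 1 = p * k := by
    have hq0 : (q : ℤ) ≠ 0 := by positivity
    apply mul_right_cancel₀ hq0
    rw [← hZ, hk]; ring
  have hk0 : 0 ≤ k := by
    by_contra hneg
    have hk1 : k ≤ -1 := by omega
    have a1 : (q : ℤ) ≤ 1 := by nlinarith
    have a2 : (p : ℤ) ≤ 1 := by nlinarith
    omega
  lift k to ℕ using hk0
  refine ⟨k, ?_, ?_⟩
  · zify; linarith
  · zify; linarith
end

section
/- With the hypotheses of the cofactor identity — U ⊆ ℝ² a connected open neighborhood of p₀; P, Q analytic with P(p₀) = Q(p₀) = 0; f₁, f₂, u analytic and not identically zero with u(p₀) ≠ 0; f₁(p₀) = f₂(p₀) = 0; X fᵢ = Kᵢ fᵢ with Kᵢ analytic; V = f₁^{m₁} f₂^{m₂} u an inverse integrating factor of X = P ∂x + Q ∂y with m₁, m₂ nonnegative integers — assume moreover that K₁(p₀) = λ > 0, K₂(p₀) = −λ, that (div X)(p₀) = 0 (weak saddle), and that V(p₀) = 0. Then m₁ = m₂ = m for some natural number m ≥ 1. -/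
/-- At a weak hyperbolic saddle (eigenvalues `λ` and `−λ`, zero divergence),
if the analytic inverse integrating factor `V = f₁^{m₁} f₂^{m₂} u` with
`u(p₀) ≠ 0` vanishes at `p₀`, then `m₁ = m₂ = m` for some `m ≥ 1`. -/
theorem stmt_13
    (U : Set (ℝ × ℝ)) (hU : IsOpen U) (hUc : IsPreconnected U)
    (p₀ : ℝ × ℝ) (hp₀ : p₀ ∈ U)
    (P Q f₁ f₂ u K₁ K₂ : ℝ × ℝ → ℝ) (m₁ m₂ : ℕ)
    (hP : ∀ z ∈ U, AnalyticAt ℝ P z) (hQ : ∀ z ∈ U, AnalyticAt ℝ Q z)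
    (hf₁ : ∀ z ∈ U, AnalyticAt ℝ f₁ z) (hf₂ : ∀ z ∈ U, AnalyticAt ℝ f₂ z)
    (hu : ∀ z ∈ U, AnalyticAt ℝ u z)
    (hK₁ : ∀ z ∈ U, AnalyticAt ℝ K₁ z) (hK₂ : ∀ z ∈ U, AnalyticAt ℝ K₂ z)
    (hP0 : P p₀ = 0) (hQ0 : Q p₀ = 0)
    (hf₁ne : ∃ z ∈ U, f₁ z ≠ 0) (hf₂ne : ∃ z ∈ U, f₂ z ≠ 0)
    (hu0 : u p₀ ≠ 0)
    (hinv₁ : ∀ z ∈ U,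
      P z * fderiv ℝ f₁ z (1, 0) + Q z * fderiv ℝ f₁ z (0, 1) = K₁ z * f₁ z)
    (hinv₂ : ∀ z ∈ U,
      P z * fderiv ℝ f₂ z (1, 0) + Q z * fderiv ℝ f₂ z (0, 1) = K₂ z * f₂ z)
    (hiif : ∀ z ∈ U,
      P z * fderiv ℝ (fun w => f₁ w ^ m₁ * f₂ w ^ m₂ * u w) z (1, 0)
        + Q z * fderiv ℝ (fun w => f₁ w ^ m₁ * f₂ w ^ m₂ * u w) z (0, 1)
        = (f₁ z ^ m₁ * f₂ z ^ m₂ * u z)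
            * (fderiv ℝ P z (1, 0) + fderiv ℝ Q z (0, 1)))
    (hf₁0 : f₁ p₀ = 0) (hf₂0 : f₂ p₀ = 0)
    (lam : ℝ) (hlam : 0 < lam)
    (hK₁0 : K₁ p₀ = lam) (hK₂0 : K₂ p₀ = -lam)
    (hdiv : fderiv ℝ P p₀ (1, 0) + fderiv ℝ Q p₀ (0, 1) = 0)
    (hV0 : f₁ p₀ ^ m₁ * f₂ p₀ ^ m₂ * u p₀ = 0) :
    ∃ m : ℕ, 1 ≤ m ∧ m₁ = m ∧ m₂ = m := by
  have key : ∀ z ∈ U, f₁ z ≠ 0 → f₂ z ≠ 0 →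
      u z * (m₁ * K₁ z + m₂ * K₂ z - (fderiv ℝ P z (1, 0) + fderiv ℝ Q z (0, 1)))
        + (P z * fderiv ℝ u z (1, 0) + Q z * fderiv ℝ u z (0, 1)) = 0 := by
    intro z hz h1 h2
    have d1 := (hf₁ z hz).differentiableAt.hasFDerivAt
    have d2 := (hf₂ z hz).differentiableAt.hasFDerivAt
    have d3 := (hu z hz).differentiableAt.hasFDerivAt
    have d : HasFDerivAt (fun w => f₁ w ^ m₁ * f₂ w ^ m₂ * u w) _ z :=
      ((d1.pow m₁).mul (d2.pow m₂)).mul d3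
    have e := hiif z hz
    rw [d.fderiv] at e
    have i1 := hinv₁ z hz
    have i2 := hinv₂ z hz
    have pw : ∀ (a : ℝ) (n : ℕ), (n : ℝ) * a ^ (n - 1) * a = n * a ^ n := by
      intro a n
      cases n with
      | zero => simp
      | succ k => simp [pow_succ, mul_assoc]
    have p1 := pw (f₁ z) m₁
    have p2 := pw (f₂ z) m₂
    have hne : f₁ z ^ m₁ * f₂ z ^ m₂ ≠ 0 := mul_ne_zero (pow_ne_zero _ h1) (pow_ne_zero _ h2)
    apply mul_left_cancel₀ hne
    simp at e
    generalize fderiv ℝ f₁ z (1, 0) = a1 at *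
    generalize fderiv ℝ f₁ z (0, 1) = a2 at *
    generalize fderiv ℝ f₂ z (1, 0) = b1 at *
    generalize fderiv ℝ f₂ z (0, 1) = b2 at *
    generalize fderiv ℝ u z (1, 0) = c1 at *
    generalize fderiv ℝ u z (0, 1) = c2 at *
    generalize fderiv ℝ P z (1, 0) = dP at *
    generalize fderiv ℝ Q z (0, 1) = dQ at *
    generalize f₁ z ^ (m₁ - 1) = A at *
    generalize f₂ z ^ (m₂ - 1) = B at *
    generalize f₁ z ^ m₁ = F at *
    generalize f₂ z ^ m₂ = G at *
    linear_combination e - (m₁ * A * G * u z) * i1 - (m₂ * B * F * u z) * i2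
      - (G * u z * K₁ z) * p1 - (F * u z * K₂ z) * p2
  have nz : ∀ f : ℝ × ℝ → ℝ, (∀ z ∈ U, AnalyticAt ℝ f z) → (∃ z ∈ U, f z ≠ 0) →
      ∀ z ∈ U, ∃ᶠ w in nhds z, f w ≠ 0 := by
    rintro f hf ⟨y, hy, hfy⟩ z hz hcon
    have h0 : f =ᶠ[nhds z] 0 := by
      filter_upwards [hcon] with w hw
      simpa using hw
    exact hfy (AnalyticOnNhd.eqOn_zero_of_preconnected_of_eventuallyEq_zero hf hUc hz h0 hy)
  have hUn : ∀ᶠ z in nhds p₀, z ∈ U := hU.mem_nhds hp₀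
  have freq : ∃ᶠ z in nhds p₀, f₁ z ≠ 0 ∧ f₂ z ≠ 0 := by
    intro hcon
    obtain ⟨z, h1, h2, h3⟩ := ((nz f₁ hf₁ hf₁ne p₀ hp₀).and_eventually
      ((eventually_eventually_nhds.2 hcon).and hUn)).exists
    have h4 : ∀ᶠ w in nhds z, f₁ w ≠ 0 := (hf₁ z h3).continuousAt.eventually_ne h1
    refine nz f₂ hf₂ hf₂ne z h3 ?_
    filter_upwards [h2, h4] with w hw hw' hw2
    exact hw ⟨hw', hw2⟩
  have cd : ∀ f : ℝ × ℝ → ℝ, (∀ z ∈ U, AnalyticAt ℝ f z) → ∀ v : ℝ × ℝ,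
      ContinuousAt (fun z => fderiv ℝ f z v) p₀ := fun f hf v =>
    (hf p₀ hp₀).fderiv.continuousAt.clm_apply continuousAt_const
  have cG : ContinuousAt (fun z => u z * (m₁ * K₁ z + m₂ * K₂ z -
      (fderiv ℝ P z (1, 0) + fderiv ℝ Q z (0, 1)))
        + (P z * fderiv ℝ u z (1, 0) + Q z * fderiv ℝ u z (0, 1))) p₀ := by
    have := (hK₁ p₀ hp₀).continuousAt
    have := (hK₂ p₀ hp₀).continuousAt
    have := (hu p₀ hp₀).continuousAt
    have := (hP p₀ hp₀).continuousAt
    have := (hQ p₀ hp₀).continuousAt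
    have := cd P hP (1, 0)
    have := cd Q hQ (0, 1)
    have := cd u hu (1, 0)
    have := cd u hu (0, 1)
    fun_prop
  have G0 : u p₀ * (m₁ * K₁ p₀ + m₂ * K₂ p₀ -
      (fderiv ℝ P p₀ (1, 0) + fderiv ℝ Q p₀ (0, 1)))
        + (P p₀ * fderiv ℝ u p₀ (1, 0) + Q p₀ * fderiv ℝ u p₀ (0, 1)) = 0 := by
    by_contra hne
    obtain ⟨z, ⟨h1, h2⟩, h3, h4⟩ :=
      (freq.and_eventually ((cG.eventually_ne hne).and hUn)).exists
    exact h3 (key z h4 h1 h2)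
  rw [hdiv, hP0, hQ0, hK₁0, hK₂0] at G0
  have h5 : u p₀ * lam * ((m₁ : ℝ) - m₂) = 0 := by linear_combination G0
  have h6 : (m₁ : ℝ) - m₂ = 0 :=
    (mul_eq_zero.1 h5).resolve_left (mul_ne_zero hu0 hlam.ne')
  have h7 : m₁ = m₂ := by exact_mod_cast sub_eq_zero.1 h6
  refine ⟨m₁, ?_, rfl, h7.symm⟩
  rcases Nat.eq_zero_or_pos m₁ with h | h
  · rw [← h7, h] at hV0
    simp at hV0
    exact absurd hV0 hu0
  · exact h
end

section
/- Let U ⊆ ℝ² be open, let P, Q : U → ℝ be C¹, and let V and V̄ be two C¹ inverse integrating factors of X = P ∂x + Q ∂y on U with V̄ nowhere vanishing on U. Then H := V / V̄ is a first integral of X on U, i.e. P ∂H/∂x + Q ∂H/∂y = 0 on U. -/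
/-- The quotient of two C¹ inverse integrating factors, the denominator being
nowhere vanishing, is a first integral: `X (V / V̄) = 0` on `U`. -/
theorem stmt_14
    (U : Set (ℝ × ℝ)) (hU : IsOpen U)
    (P Q V W : ℝ × ℝ → ℝ)
    (hP : ContDiffOn ℝ 1 P U) (hQ : ContDiffOn ℝ 1 Q U)
    (hV : ContDiffOn ℝ 1 V U) (hW : ContDiffOn ℝ 1 W U)
    (hViif : ∀ z ∈ U,
      P z * fderiv ℝ V z (1, 0) + Q z * fderiv ℝ V z (0, 1)
        = V z * (fderiv ℝ P z (1, 0) + fderiv ℝ Q z (0, 1)))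
    (hWiif : ∀ z ∈ U,
      P z * fderiv ℝ W z (1, 0) + Q z * fderiv ℝ W z (0, 1)
        = W z * (fderiv ℝ P z (1, 0) + fderiv ℝ Q z (0, 1)))
    (hWne : ∀ z ∈ U, W z ≠ 0) :
    ∀ z ∈ U,
      P z * fderiv ℝ (fun w => V w / W w) z (1, 0)
        + Q z * fderiv ℝ (fun w => V w / W w) z (0, 1) = 0 := by
  intro z hz
  have hn := hU.mem_nhds hz
  have dV : DifferentiableAt ℝ V z := (hV.contDiffAt hn).differentiableAt (by norm_num)
  have dW : DifferentiableAt ℝ W z := (hW.contDiffAt hn).differentiableAt (by norm_num)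
  have w0 := hWne z hz
  have dH : DifferentiableAt ℝ (fun w => V w / W w) z := by
    simpa only [div_eq_mul_inv] using dV.fun_mul (dW.fun_inv w0)
  have e : V =ᶠ[nhds z] fun w => (V w / W w) * W w := by
    filter_upwards [hn] with w hw
    rw [div_mul_cancel₀ _ (hWne w hw)]
  have k : fderiv ℝ V z = (V z / W z) • fderiv ℝ W z
      + W z • fderiv ℝ (fun w => V w / W w) z :=
    e.fderiv_eq.trans (fderiv_fun_mul dH dW)
  have h1 := hViif z hz
  have h2 := hWiif z hz
  rw [k] at h1
  generalize fderiv ℝ (fun w => V w / W w) z = H at h1 ⊢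
  simp only [ContinuousLinearMap.add_apply,
    ContinuousLinearMap.smul_apply, smul_eq_mul] at h1
  have h3 : V z / W z * W z = V z := div_mul_cancel₀ _ w0
  refine (mul_eq_zero.mp ?_).resolve_left w0
  linear_combination h1 - (V z / W z) * h2 - (fderiv ℝ P z (1, 0) + fderiv ℝ Q z (0, 1)) * h3
end

section
/- Let g, h : ℝ → ℝ be differentiable functions. Define the planar vector field P(X,Y) = X · g(XY), Q(X,Y) = −Y · h(XY). Then V(X,Y) = X Y (g(XY) − h(XY)) is an inverse integrating factor of X = P ∂X + Q ∂Y on ℝ², i.e. P ∂V/∂X + Q ∂V/∂Y = V (∂P/∂X + ∂Q/∂Y) identically. -/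
/-- For the vector field `Ẋ = X g(XY)`, `Ẏ = −Y h(XY)` (the Poincaré normal
form of a weak saddle), `V = XY (g(XY) − h(XY))` is an inverse integrating
factor. -/
theorem stmt_15
    (g h : ℝ → ℝ) (hg : Differentiable ℝ g) (hh : Differentiable ℝ h) :
    ∀ z : ℝ × ℝ,
      (z.1 * g (z.1 * z.2)) *
          fderiv ℝ (fun w : ℝ × ℝ =>
            w.1 * w.2 * (g (w.1 * w.2) - h (w.1 * w.2))) z (1, 0)
        + (-(z.2 * h (z.1 * z.2))) *
          fderiv ℝ (fun w : ℝ × ℝ =>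
            w.1 * w.2 * (g (w.1 * w.2) - h (w.1 * w.2))) z (0, 1)
      = (z.1 * z.2 * (g (z.1 * z.2) - h (z.1 * z.2))) *
          (fderiv ℝ (fun w : ℝ × ℝ => w.1 * g (w.1 * w.2)) z (1, 0)
            + fderiv ℝ (fun w : ℝ × ℝ => -(w.2 * h (w.1 * w.2))) z (0, 1)) := by
  intro z
  have h1 : HasFDerivAt (fun w : ℝ × ℝ => w.1) (ContinuousLinearMap.fst ℝ ℝ ℝ) z := hasFDerivAt_fst
  have h2 : HasFDerivAt (fun w : ℝ × ℝ => w.2) (ContinuousLinearMap.snd ℝ ℝ ℝ) z := hasFDerivAt_snd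
  have hu := h1.mul h2
  have hG := (hg (z.1 * z.2)).hasDerivAt.comp_hasFDerivAt z hu
  have hH := (hh (z.1 * z.2)).hasDerivAt.comp_hasFDerivAt z hu
  have hV : HasFDerivAt (fun w : ℝ × ℝ => w.1 * w.2 * (g (w.1 * w.2) - h (w.1 * w.2))) _ z :=
    hu.mul (hG.sub hH)
  have hP : HasFDerivAt (fun w : ℝ × ℝ => w.1 * g (w.1 * w.2)) _ z := h1.mul hG
  have hQ : HasFDerivAt (fun w : ℝ × ℝ => -(w.2 * h (w.1 * w.2))) _ z := (h2.mul hH).neg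
  rw [hV.fderiv, hP.fderiv, hQ.fderiv]
  simp
  ring
end

section
/- Let p, q, ℓ be natural numbers with p, q, ℓ ≥ 1 and let c ∈ ℝ, c ≠ 0. Then there is no polynomial W ∈ ℝ[X,Y] satisfying p X ∂W/∂X − q Y ∂W/∂Y = c X^{ℓq} Y^{ℓp}. -/
open MvPolynomial in
theorem coeff_euler_aux (i : Fin 2) (W : MvPolynomial (Fin 2) ℝ) (m : Fin 2 →₀ ℕ) :
    coeff m (X i * pderiv i W) = (m i : ℝ) * coeff m W := by
  induction W using MvPolynomial.induction_on' with
  | monomial u a =>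
    rw [X_mul_pderiv_monomial, coeff_smul, coeff_monomial]
    split_ifs with h
    · subst h; simp
    · simp
  | add f g hf hg => rw [map_add, mul_add, coeff_add, coeff_add, hf, hg, mul_add]

open MvPolynomial in
/-- The linear PDE `p X ∂W/∂X − q Y ∂W/∂Y = c X^{ℓq} Y^{ℓp}` (with `c ≠ 0`)
has no polynomial solution `W`: the operator is diagonal on monomials and the
right-hand side monomial lies in its kernel direction. -/
theorem stmt_16
    (p q ℓ : ℕ) (hp : 1 ≤ p) (hq : 1 ≤ q) (hℓ : 1 ≤ ℓ)
    (c : ℝ) (hc : c ≠ 0) :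
    ¬ ∃ W : MvPolynomial (Fin 2) ℝ,
      C (p : ℝ) * X 0 * pderiv 0 W - C (q : ℝ) * X 1 * pderiv 1 W
        = C c * X 0 ^ (ℓ * q) * X 1 ^ (ℓ * p) := by
  rintro ⟨W, hW⟩
  have h := congrArg (coeff (Finsupp.single 0 (ℓ * q) + Finsupp.single 1 (ℓ * p))) hW
  rw [coeff_sub, mul_assoc, mul_assoc, mul_assoc, coeff_C_mul, coeff_C_mul, coeff_C_mul,
    coeff_euler_aux, coeff_euler_aux, X_pow_eq_monomial, X_pow_eq_monomial, monomial_mul,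
    coeff_monomial, if_pos rfl] at h
  simp at h
  apply hc
  rw [← h]
  ring
end

section
/- For all real parameters λ, m₁, m₂, consider the polynomial vector field P(x,y) = λx − y + λm₁x³ + (m₂ − m₁ + m₁m₂)x²y + λm₁m₂xy² + m₂y³, Q(x,y) = x + λy − x³ + λm₁x²y + (m₁m₂ − m₁ − 1)xy² + λm₁m₂y³. Then V(x,y) = (x² + y²)(1 + m₁x² + m₁m₂y²) is an inverse integrating factor of this system: P ∂V/∂x + Q ∂V/∂y = V (∂P/∂x + ∂Q/∂y) holds identically on ℝ². -/
/-- For every `λ, m₁, m₂ ∈ ℝ`, `V = (x² + y²)(1 + m₁x² + m₁m₂y²)` is an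
inverse integrating factor of the cubic system of Example 1. -/
theorem stmt_18 (lam m₁ m₂ : ℝ) :
    ∀ z : ℝ × ℝ,
      (lam * z.1 - z.2 + lam * m₁ * z.1 ^ 3 + (m₂ - m₁ + m₁ * m₂) * z.1 ^ 2 * z.2
          + lam * m₁ * m₂ * z.1 * z.2 ^ 2 + m₂ * z.2 ^ 3) *
        fderiv ℝ (fun w : ℝ × ℝ =>
          (w.1 ^ 2 + w.2 ^ 2) * (1 + m₁ * w.1 ^ 2 + m₁ * m₂ * w.2 ^ 2)) z (1, 0)
      + (z.1 + lam * z.2 - z.1 ^ 3 + lam * m₁ * z.1 ^ 2 * z.2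
          + (m₁ * m₂ - m₁ - 1) * z.1 * z.2 ^ 2 + lam * m₁ * m₂ * z.2 ^ 3) *
        fderiv ℝ (fun w : ℝ × ℝ =>
          (w.1 ^ 2 + w.2 ^ 2) * (1 + m₁ * w.1 ^ 2 + m₁ * m₂ * w.2 ^ 2)) z (0, 1)
      = ((z.1 ^ 2 + z.2 ^ 2) * (1 + m₁ * z.1 ^ 2 + m₁ * m₂ * z.2 ^ 2)) *
          (fderiv ℝ (fun w : ℝ × ℝ =>
              lam * w.1 - w.2 + lam * m₁ * w.1 ^ 3 + (m₂ - m₁ + m₁ * m₂) * w.1 ^ 2 * w.2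
                + lam * m₁ * m₂ * w.1 * w.2 ^ 2 + m₂ * w.2 ^ 3) z (1, 0)
            + fderiv ℝ (fun w : ℝ × ℝ =>
              w.1 + lam * w.2 - w.1 ^ 3 + lam * m₁ * w.1 ^ 2 * w.2
                + (m₁ * m₂ - m₁ - 1) * w.1 * w.2 ^ 2 + lam * m₁ * m₂ * w.2 ^ 3) z (0, 1)) := by
  rintro ⟨x, y⟩
  simp (disch := fun_prop) only [fderiv_fun_add, fderiv_fun_sub, fderiv_fun_mul, fderiv_fun_pow,
    fderiv_fst, fderiv_snd, fderiv_const_apply]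
  simp
  ring
end
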